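/- No nonempty open subset U of the Heisenberg group H, equipped with the Carnot–Carathéodory distance d, admits a bi-Lipschitz embedding into L¹: there exist no map f : U → L¹ and constant C ≥ 1 such that (1/C)·d(x,y) ≤ ‖f(x)−f(y)‖₁ ≤ C·d(x,y) for all x,y ∈ U. -/

import Mathlib

open MeasureTheory Set Topology Filter

noncomputable section

/-- The Heisenberg group as a set: `ℝ³`. -/
abbrev Heis : Type := ℝ × ℝ × ℝ

/-- The Heisenberg group multiplication
`(a,b,c)·(a',b',c') = (a+a', b+b', c+c'+a·b')`. -/
def hMul (x y : Heis) : Heis :=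
  (x.1 + y.1, x.2.1 + y.2.1, x.2.2 + y.2.2 + x.1 * y.2.1)

/-- The abelianization homomorphism `π : H → ℝ²`, `π(a,b,c) = (a,b)`. -/
def hPi (x : Heis) : ℝ × ℝ := (x.1, x.2.1)

/-- A Lipschitz path `c : [0,1] → H` is horizontal with (a.e.) component derivatives
`v₁, v₂` if `c₁' = v₁`, `c₂' = v₂` and `c₃'(t) = c₁(t)·c₂'(t)` hold almost everywhere
on `[0,1]`. -/
def IsHorizPath (c : ℝ → Heis) (v₁ v₂ : ℝ → ℝ) : Prop :=
  ∀ᵐ t ∂(volume : Measure ℝ), t ∈ Icc (0 : ℝ) 1 →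
    HasDerivAt (fun u => (c u).1) (v₁ t) t ∧
    HasDerivAt (fun u => (c u).2.1) (v₂ t) t ∧
    HasDerivAt (fun u => (c u).2.2) ((c t).1 * v₂ t) t

/-- The length `∫₀¹ √(c₁'(t)² + c₂'(t)²) dt` of a horizontal path. -/
def pathLen (v₁ v₂ : ℝ → ℝ) : ℝ :=
  ∫ t in (0 : ℝ)..1, Real.sqrt (v₁ t ^ 2 + v₂ t ^ 2)

/-- The Carnot–Carathéodory distance on the Heisenberg group: the infimum of lengths
of Lipschitz horizontal paths joining the two points. -/
def ccDist (x y : Heis) : ℝ :=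
  sInf { l : ℝ | ∃ c : ℝ → Heis, ∃ v₁ v₂ : ℝ → ℝ,
    (∃ K : NNReal, LipschitzOnWith K c (Icc 0 1)) ∧
    IsHorizPath c v₁ v₂ ∧
    IntervalIntegrable (fun t => Real.sqrt (v₁ t ^ 2 + v₂ t ^ 2)) volume 0 1 ∧
    c 0 = x ∧ c 1 = y ∧ l = pathLen v₁ v₂ }

/-- Three families of directions in the plane, such that a direction of the second family never
lies strictly between a direction of the first and a direction of the third which is less than
half a turn further counterclockwise. -/
structure DirectionTriple (A B C : ℝ → ℝ → Prop) : Prop where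
  smulA : ∀ {r a b : ℝ}, 0 < r → A a b → A (r * a) (r * b)
  smulB : ∀ {r a b : ℝ}, 0 < r → B a b → B (r * a) (r * b)
  smulC : ∀ {r a b : ℝ}, 0 < r → C a b → C (r * a) (r * b)
  totalA : ∀ a b, A a b ∨ A (-a) (-b)
  totalB : ∀ a b, B a b ∨ B (-a) (-b)
  totalC : ∀ a b, C a b ∨ C (-a) (-b)
  not_between : ∀ {a b c d x y e f : ℝ}, A a b → C c d → 0 < a * d - b * c → 0 < x → 0 < y →
    e = x * a + y * c → f = x * b + y * d → ¬ B e f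

/-- The first and third families contain an open half-plane, the second one its opposite. -/
def SplitByHalfPlane (A B C : ℝ → ℝ → Prop) : Prop :=
  ∃ α β : ℝ, (α ≠ 0 ∨ β ≠ 0) ∧
    ∀ a b, 0 < α * a + β * b → A a b ∧ C a b ∧ B (-a) (-b)

namespace DirectionTriple

variable {A B C : ℝ → ℝ → Prop}

lemma split_of_opposite_axis (h : DirectionTriple A B C) (hA : A 1 0) (hC : C (-1) 0) :
    SplitByHalfPlane A B C := by
  by_cases hB : ∃ a b, 0 < b ∧ B a b
  · obtain ⟨a, b, hb, hB⟩ := hB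
    have C_of : ∀ {a b x : ℝ}, 0 < b → 0 < x → B a b → C (x - a) (-b) := by
      intro a b x hb hx hB
      rcases h.totalC (a - x) b with h' | h'
      · exact absurd hB (h.not_between hA h' (by linarith) hx one_pos (by ring) (by ring))
      · rwa [neg_sub] at h'
    have A_of : ∀ {a b x : ℝ}, 0 < b → 0 < x → B a b → A (-x - a) (-b) := by
      intro a b x hb hx hB
      rcases h.totalA (x + a) b with h' | h'
      · exact absurd hB (h.not_between h' hC (by linarith) one_pos hx (by ring) (by ring))
      · rwa [neg_add'] at h'
    have B_level : ∀ s, B s b := by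
      intro s
      rcases h.totalB s b with h' | h'
      · exact h'
      · refine absurd h' (h.not_between (x := 1 / 2) (y := 1 / 2)
          (A_of (x := |s - a| + 1 + (s - a)) hb ?_ hB) (C_of (x := |s - a| + 1 - (s - a)) hb ?_ hB)
          ?_ (by norm_num) (by norm_num) (by ring) (by ring))
        · linarith [neg_abs_le (s - a)]
        · linarith [le_abs_self (s - a)]
        · have := mul_pos hb (by positivity : 0 < |s - a| + 1)
          linarith
    have B_upper : ∀ s t, 0 < t → B s t := by
      intro s t ht
      have := h.smulB (r := t / b) (by positivity) (B_level (b / t * s))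
      convert this using 1 <;> field_simp
    refine ⟨0, -1, Or.inr (by norm_num), fun s t hst => ?_⟩
    have ht : 0 < -t := by linarith
    refine ⟨?_, ?_, B_upper _ _ ht⟩
    · convert A_of (x := 1) ht one_pos (B_upper (-1 - s) _ ht) using 1 <;> ring
    · convert C_of (x := 1) ht one_pos (B_upper (1 - s) _ ht) using 1 <;> ring
  · push Not at hB
    have B_lower : ∀ a b, b < 0 → B a b := by
      intro a b hb
      have := h.totalB a b
      exact this.resolve_right (hB _ _ (by linarith))
    have A_upper : ∀ a b, 0 < b → A a b := by
      intro a b hb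
      by_contra hna
      have hA' := (h.totalA a b).resolve_left hna
      have C_of : ∀ {k s : ℝ}, 0 < s → C (k * a - s) (k * b) := by
        intro k s hs
        rcases h.totalC (k * a - s) (k * b) with h' | h'
        · exact h'
        · have hk : 0 < |k| + 1 := by positivity
          refine absurd (B_lower (-a + s / (|k| + 1)) (-b) (by linarith))
            (h.not_between (x := (|k| + 1 - k) / (|k| + 1)) (y := 1 / (|k| + 1)) hA' h' ?_ ?_ ?_ ?_ ?_)
          · nlinarith
          · have := le_abs_self k
            apply div_pos _ hk
            linarith
          · positivity
          · field_simp
            ring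
          · field_simp
            ring
      have notA : ∀ {m n k s : ℝ}, m + k < 0 → 0 < s → 0 < m * s + n * k →
          ¬ A (m * a + n) (m * b) := by
        intro m n k s hmk hs hmn h'
        refine h.not_between (x := 1) (y := 1) h' (C_of (k := k) hs) ?_ one_pos one_pos rfl rfl
          (B_lower _ _ ?_)
        · have := mul_pos hb hmn
          linarith
        · nlinarith
      rcases h.totalA (-1 * a + 1) (-1 * b) with h' | h'
      · exact notA (k := 1 / 2) (s := 1 / 4) (by norm_num) (by norm_num) (by norm_num) h'
      · refine notA (m := 1) (n := -1) (k := -2) (s := 1) (by norm_num) (by norm_num)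
          (by norm_num) ?_
        convert h' using 1 <;> ring
    refine ⟨0, 1, Or.inr one_ne_zero, fun a b hab => ?_⟩
    have hb : 0 < b := by linarith
    refine ⟨A_upper _ _ hb, ?_, B_lower _ _ (by linarith)⟩
    refine (h.totalC a b).resolve_right fun h' => ?_
    refine h.not_between (x := 1) (y := 2) (A_upper (a - 1) b hb) h' ?_ one_pos two_pos rfl rfl
      (B_lower _ _ ?_)
    · linarith
    · linarith

lemma split_of_common_axis (h : DirectionTriple A B C)
    (hAC : ∀ a b, (a ≠ 0 ∨ b ≠ 0) → (A a b ↔ C a b)) (hA : A 1 0) (hB : B 1 0) :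
    SplitByHalfPlane A B C := by
  have hC : C 1 0 := (hAC _ _ (Or.inl one_ne_zero)).1 hA
  have hAC' : ∀ {a b}, b ≠ 0 → A a b → C a b := fun hb => (hAC _ _ (Or.inr hb)).1
  have hCA' : ∀ {a b}, b ≠ 0 → C a b → A a b := fun hb => (hAC _ _ (Or.inr hb)).2
  have notB : ∀ {a b x : ℝ}, 0 < b → 0 < x → A a b → ¬ B (a + x) b := by
    intro a b x hb hx h'
    exact h.not_between hA (hAC' hb.ne' h') (by linarith) hx one_pos (by ring) (by ring)
  have notB' : ∀ {a b x : ℝ}, 0 < b → 0 < x → A (-a) (-b) → ¬ B (x - a) (-b) := by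
    intro a b x hb hx h'
    exact h.not_between h' hC (by linarith) one_pos hx (by ring) (by ring)
  have notA : ∀ {a b x : ℝ}, 0 < b → 0 < x → A (-a) (-b) → ¬ A (a + x) b := by
    intro a b x hb hx h' h''
    exact h.not_between (x := 1 / x) (y := 1 / x) h' (hAC' hb.ne' h'') (by nlinarith)
      (by positivity) (by positivity) (by field_simp; ring) (by ring) hB
  by_cases h1 : ∀ a b, 0 < b → A a b
  · refine ⟨0, 1, Or.inr one_ne_zero, fun a b hab => ?_⟩
    have hb : 0 < b := by linarith
    refine ⟨h1 _ _ hb, hAC' hb.ne' (h1 _ _ hb), (h.totalB a b).resolve_left ?_⟩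
    convert notB hb one_pos (h1 (a - 1) b hb) using 2
    ring
  · push Not at h1
    obtain ⟨a₂, b₂, hb₂, h2⟩ := h1
    by_cases h3 : ∃ a b, 0 < b ∧ A a b
    · exfalso
      obtain ⟨a₁, b₁, hb₁, h3⟩ := h3
      have h2' := (h.totalA _ _).resolve_left h2
      set r := b₂ / b₁ with hr
      have hr0 : 0 < r := by positivity
      have h3' := h.smulA hr0 h3
      have hrb : r * b₁ = b₂ := by rw [hr]; field_simp
      rw [hrb] at h3'
      rcases lt_trichotomy (r * a₁) a₂ with hlt | heq | hgt
      · rcases h.totalB ((r * a₁ + a₂) / 2) b₂ with hb | hb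
        · refine notB (x := (a₂ - r * a₁) / 2) hb₂ (by linarith) h3' ?_
          convert hb using 1; ring
        · refine notB' (x := (a₂ - r * a₁) / 2) hb₂ (by linarith) h2' ?_
          convert hb using 1; ring
      · rw [heq] at h3'
        exact h2 h3'
      · refine notA (x := r * a₁ - a₂) hb₂ (by linarith) h2' ?_
        convert h3' using 1; ring
    · push Not at h3
      refine ⟨0, -1, Or.inr (by norm_num), fun a b hab => ?_⟩
      have hb : 0 < -b := by linarith
      have hA' : ∀ s t, t < 0 → A s t := fun s t ht =>
        (h.totalA s t).resolve_right (h3 _ _ (by linarith))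
      refine ⟨hA' _ _ (by linarith), hAC' (by linarith) (hA' _ _ (by linarith)), 
        (h.totalB a b).resolve_left ?_⟩
      have := notB' (a := 1 - a) (x := 1) hb one_pos (hA' _ _ (by linarith))
      convert this using 2 <;> ring

lemma split_of_convex (h : DirectionTriple A B C) (hA : A 1 0)
    (hAB : ∀ a b, (a ≠ 0 ∨ b ≠ 0) → A a b → B (-a) (-b))
    (hAC : ∀ a b, (a ≠ 0 ∨ b ≠ 0) → (A a b ↔ C a b))
    (hBA : ∀ a b, (a ≠ 0 ∨ b ≠ 0) → ¬ B a b → A a b) :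
    SplitByHalfPlane A B C := by
  suffices H : ∃ α β : ℝ, (α ≠ 0 ∨ β ≠ 0) ∧ ∀ a b, 0 < α * a + β * b → A a b by
    obtain ⟨α, β, h0, H⟩ := H
    refine ⟨α, β, h0, fun a b hab => ?_⟩
    have hne : a ≠ 0 ∨ b ≠ 0 := by
      by_contra! hc
      simp [hc.1, hc.2] at hab
    exact ⟨H _ _ hab, (hAC _ _ hne).1 (H _ _ hab), hAB _ _ hne (H _ _ hab)⟩
  have up : ∀ {r s : ℝ}, r < s → A r 1 → A s 1 := by
    intro r s hrs hr
    refine hBA _ _ (Or.inr one_ne_zero) (h.not_between (x := s - r) (y := 1) hA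
      ((hAC _ _ (Or.inr one_ne_zero)).1 hr) (by norm_num) (by linarith) one_pos (by ring) (by ring))
  have upper : ∀ {a b : ℝ}, 0 < b → A (a / b) 1 → A a b := by
    intro a b hb h'
    convert h.smulA hb h' using 1 <;> field_simp
  have lower : ∀ {a b : ℝ}, b < 0 → ¬ A (a / b) 1 → A a b := by
    intro a b hb h'
    have := h.smulA (r := -b) (by linarith) ((h.totalA _ _).resolve_left h')
    have hb' := hb.ne
    convert this using 1 <;> field_simp
  have hbdd : ∀ {r₁ : ℝ}, ¬ A r₁ 1 → ∀ r ∈ {r | A r 1}, r₁ ≤ r := by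
    intro r₁ hr₁ r hr
    by_contra! hlt
    exact hr₁ (up hlt hr)
  by_cases h1 : ∀ r, A r 1
  · exact ⟨0, 1, Or.inr one_ne_zero, fun a b hab => upper (by linarith) (h1 _)⟩
  by_cases h2 : ∀ r, ¬ A r 1
  · exact ⟨0, -1, Or.inr (by norm_num), fun a b hab => lower (by linarith) (h2 _)⟩
  push Not at h1 h2
  obtain ⟨r₁, hr₁⟩ := h1
  set r₀ := sInf {r | A r 1} with hr₀
  refine ⟨1, -r₀, Or.inl one_ne_zero, fun a b hab => ?_⟩
  rcases lt_trichotomy b 0 with hb | hb | hb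
  · refine lower hb fun h' => ?_
    have h3 := csInf_le ⟨r₁, fun r hr => hbdd hr₁ r hr⟩ h'
    rw [← hr₀, le_div_iff_of_neg hb] at h3
    linarith
  · subst hb
    convert h.smulA (r := a) (by linarith) hA using 1 <;> ring
  · have h3 : r₀ < a / b := by
      rw [lt_div_iff₀ hb]; linarith
    obtain ⟨r, hr, hlt⟩ := exists_lt_of_csInf_lt h2 h3
    exact upper hb (up hlt hr)

lemma rotate (h : DirectionTriple A B C) {u v : ℝ} (huv : u ≠ 0 ∨ v ≠ 0) :
    DirectionTriple (fun a b => A (a * u - b * v) (a * v + b * u))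
      (fun a b => B (a * u - b * v) (a * v + b * u))
      (fun a b => C (a * u - b * v) (a * v + b * u)) where
  smulA hr h' := by convert h.smulA hr h' using 1 <;> ring
  smulB hr h' := by convert h.smulB hr h' using 1 <;> ring
  smulC hr h' := by convert h.smulC hr h' using 1 <;> ring
  totalA a b := by convert h.totalA (a * u - b * v) (a * v + b * u) using 2 <;> ring
  totalB a b := by convert h.totalB (a * u - b * v) (a * v + b * u) using 2 <;> ring
  totalC a b := by convert h.totalC (a * u - b * v) (a * v + b * u) using 2 <;> ring
  not_between {a b c d x y e f} hA hC h1 hx hy he hf := by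
    refine h.not_between hA hC ?_ hx hy ?_ ?_
    · have : 0 < u ^ 2 + v ^ 2 := by
        rcases huv with h | h <;> positivity
      nlinarith [mul_pos h1 this]
    · rw [he, hf]; ring
    · rw [he, hf]; ring

lemma _root_.SplitByHalfPlane.of_rotate {u v : ℝ} (huv : u ≠ 0 ∨ v ≠ 0)
    (h : SplitByHalfPlane (fun a b => A (a * u - b * v) (a * v + b * u))
      (fun a b => B (a * u - b * v) (a * v + b * u))
      (fun a b => C (a * u - b * v) (a * v + b * u))) : SplitByHalfPlane A B C := by
  obtain ⟨α, β, h0, H⟩ := h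
  have hD : 0 < u ^ 2 + v ^ 2 := by
    rcases huv with h | h <;> positivity
  refine ⟨α * u - β * v, α * v + β * u, ?_, fun a b hab => ?_⟩
  · by_contra! hc
    have h1 : α * (u ^ 2 + v ^ 2) = 0 := by linear_combination u * hc.1 + v * hc.2
    have h2 : β * (u ^ 2 + v ^ 2) = 0 := by linear_combination u * hc.2 - v * hc.1
    simp only [mul_eq_zero, hD.ne', or_false] at h1 h2
    simp [h1, h2] at h0
  · have := H ((a * u + b * v) / (u ^ 2 + v ^ 2)) ((b * u - a * v) / (u ^ 2 + v ^ 2)) (by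
      have : α * ((a * u + b * v) / (u ^ 2 + v ^ 2)) + β * ((b * u - a * v) / (u ^ 2 + v ^ 2)) =
        ((α * u - β * v) * a + (α * v + β * u) * b) / (u ^ 2 + v ^ 2) := by ring
      rw [this]
      positivity)
    have e1 : (a * u + b * v) / (u ^ 2 + v ^ 2) * u - (b * u - a * v) / (u ^ 2 + v ^ 2) * v = a := by
      field_simp; ring
    have e2 : (a * u + b * v) / (u ^ 2 + v ^ 2) * v + (b * u - a * v) / (u ^ 2 + v ^ 2) * u = b := by
      field_simp; ring
    simp only [e1, e2] at this
    refine ⟨this.1, this.2.1, ?_⟩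
    convert this.2.2 using 1
    · linear_combination e1
    · linear_combination e2

theorem split (h : DirectionTriple A B C) : SplitByHalfPlane A B C := by
  by_cases h1 : ∃ u v : ℝ, (u ≠ 0 ∨ v ≠ 0) ∧ A u v ∧ C (-u) (-v)
  · obtain ⟨u, v, huv, hA, hC⟩ := h1
    exact .of_rotate huv ((h.rotate huv).split_of_opposite_axis (by simpa using hA)
      (by simpa using hC))
  push Not at h1
  have hAC : ∀ a b : ℝ, (a ≠ 0 ∨ b ≠ 0) → (A a b ↔ C a b) := by
    intro a b hab
    refine ⟨fun hA => (h.totalC a b).resolve_right (h1 _ _ hab hA),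
      fun hC => (h.totalA a b).resolve_right fun hA => h1 (-a) (-b) (by simpa using hab) hA
        (by simpa using hC)⟩
  have rot : ∀ {u v : ℝ}, (u ≠ 0 ∨ v ≠ 0) → ∀ {a b : ℝ}, (a ≠ 0 ∨ b ≠ 0) →
      (a * u - b * v ≠ 0 ∨ a * v + b * u ≠ 0) := by
    intro u v huv a b hab
    by_contra! hc
    have h3 : (u ^ 2 + v ^ 2) * (a ^ 2 + b ^ 2) = 0 := by
      linear_combination (a * u - b * v) * hc.1 + (a * v + b * u) * hc.2
    have hD : 0 < u ^ 2 + v ^ 2 := by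
      rcases huv with h | h <;> positivity
    have hD' : 0 < a ^ 2 + b ^ 2 := by
      rcases hab with h | h <;> positivity
    exact (mul_pos hD hD').ne' h3
  by_cases h2 : ∃ u v : ℝ, (u ≠ 0 ∨ v ≠ 0) ∧ A u v ∧ B u v
  · obtain ⟨u, v, huv, hA, hB⟩ := h2
    exact .of_rotate huv ((h.rotate huv).split_of_common_axis
      (fun a b hab => hAC _ _ (rot huv hab)) (by simpa using hA) (by simpa using hB))
  push Not at h2
  obtain ⟨u, v, huv, hA⟩ : ∃ u v : ℝ, (u ≠ 0 ∨ v ≠ 0) ∧ A u v := by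
    rcases h.totalA 1 0 with h' | h'
    · exact ⟨_, _, Or.inl one_ne_zero, h'⟩
    · exact ⟨_, _, Or.inl (by simp), h'⟩
  refine .of_rotate huv ((h.rotate huv).split_of_convex (by simpa using hA) ?_
      (fun a b hab => hAC _ _ (rot huv hab)) ?_)
  · intro a b hab hA
    refine ((h.rotate huv).totalB a b).resolve_left (h2 _ _ (rot huv hab) hA)
  · intro a b hab hB
    by_contra hA
    have hA' := ((h.rotate huv).totalA a b).resolve_left hA
    have hB' := ((h.rotate huv).totalB a b).resolve_left hB
    exact h2 _ _ (rot huv (by simpa using hab)) hA' hB'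

end DirectionTriple

/-- The Heisenberg group law in the coordinates `(a, b, 2 * c - a * b)`. -/
def symMul (P Q : Heis) : Heis :=
  (P.1 + Q.1, P.2.1 + Q.2.1, P.2.2 + Q.2.2 + (P.1 * Q.2.1 - Q.1 * P.2.1))

lemma symMul_assoc (P Q R : Heis) : symMul (symMul P Q) R = symMul P (symMul Q R) := by
  ext <;> simp [symMul] <;> ring

/-- A two-colouring of the Heisenberg group (in the coordinates of `symMul`) which changes colour
at most once along every horizontal line. -/
def IsMonotoneColoring (E : Heis → Bool) : Prop :=
  ∀ (P : Heis) (p q s : ℝ), 0 ≤ s → s ≤ 1 → E P = E (symMul P (p, q, 0)) →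
    E (symMul P (s * p, s * q, 0)) = E P

namespace IsMonotoneColoring

variable {E : Heis → Bool}

lemma mid (hE : IsMonotoneColoring E) {x₀ y₀ t₀ x₁ y₁ t₁ x₂ y₂ t₂ : ℝ} {e : Bool} (s : ℝ)
    (hs : 0 ≤ s) (hs' : s ≤ 1) (h : t₂ = t₀ + (x₀ * y₂ - x₂ * y₀))
    (hx : x₁ = (1 - s) * x₀ + s * x₂) (hy : y₁ = (1 - s) * y₀ + s * y₂)
    (ht : t₁ = (1 - s) * t₀ + s * t₂) (h₀ : E (x₀, y₀, t₀) = e) (h₂ : E (x₂, y₂, t₂) = e) :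
    E (x₁, y₁, t₁) = e := by
  have h' : symMul (x₀, y₀, t₀) (x₂ - x₀, y₂ - y₀, 0) = (x₂, y₂, t₂) := by
    ext <;> simp [symMul, h]; ring
  have := hE (x₀, y₀, t₀) (x₂ - x₀) (y₂ - y₀) s hs hs' (by rw [h', h₀, h₂])
  rw [← h₀, ← this]
  congr 1
  ext <;> simp [symMul, hx, hy, ht, h] <;> ring

lemma translate (hE : IsMonotoneColoring E) (G : Heis) :
    IsMonotoneColoring fun P => E (symMul G P) := by
  intro P p q s hs hs' h
  simp only [← symMul_assoc] at h ⊢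
  exact hE _ _ _ _ hs hs' h

lemma directionTriple (hE : IsMonotoneColoring E) {t₀ t₁ t₂ : ℝ} {e : Bool} (h01 : t₀ < t₁)
    (h12 : t₁ < t₂) (h0 : E (0, 0, t₀) = e) (h1 : E (0, 0, t₁) = !e) (h2 : E (0, 0, t₂) = e) :
    DirectionTriple (fun a b => ∀ r, 0 ≤ r → E (r * a, r * b, t₀) = e)
      (fun a b => ∀ r, 0 ≤ r → E (r * a, r * b, t₁) = !e)
      (fun a b => ∀ r, 0 ≤ r → E (r * a, r * b, t₂) = e) := by
  have hsmul : ∀ {t : ℝ} {e : Bool} {r a b : ℝ}, 0 < r →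
      (∀ r, 0 ≤ r → E (r * a, r * b, t) = e) →
      ∀ r', 0 ≤ r' → E (r' * (r * a), r' * (r * b), t) = e := by
    intro t e r a b hr h r' hr'
    simpa only [mul_assoc] using h (r' * r) (by positivity)
  have htotal : ∀ {t : ℝ} {e : Bool}, E (0, 0, t) = e → ∀ a b : ℝ,
      (∀ r, 0 ≤ r → E (r * a, r * b, t) = e) ∨ ∀ r, 0 ≤ r → E (r * -a, r * -b, t) = e := by
    intro t e h a b
    by_contra! hc
    obtain ⟨⟨r, hr, h'⟩, r', hr', h''⟩ := hc
    have hr0 : r ≠ 0 := by rintro rfl; simp [h] at h'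
    have hpos : 0 < r + r' := by positivity
    rw [Bool.eq_not.symm] at h' h''
    have := hE.mid (r / (r + r')) (x₁ := 0) (y₁ := 0) (t₁ := t) (by positivity)
      (by rw [div_le_one hpos]; linarith) (by ring)
      (by field_simp; ring) (by field_simp; ring) (by ring) h' h''
    simp [h] at this
  refine ⟨hsmul, hsmul, hsmul, htotal h0, htotal h1, htotal h2, ?_⟩
  intro a b c d x y f g hA hC hpos hx hy hf hg hB
  have u0 : 0 < t₁ - t₀ := by linarith
  have u1 : 0 < t₂ - t₁ := by linarith
  have uT : 0 < t₂ - t₀ := by linarith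
  set r := √((t₁ - t₀) * (t₂ - t₁) / ((t₂ - t₀) * (x * y * (a * d - b * c)))) with hr
  have hr2 : r ^ 2 * ((t₂ - t₀) * (x * y * (a * d - b * c))) = (t₁ - t₀) * (t₂ - t₁) := by
    rw [hr, Real.sq_sqrt (by positivity)]
    field_simp
  have := hE.mid (x₁ := r * f) (y₁ := r * g) (t₁ := t₁) ((t₁ - t₀) / (t₂ - t₀)) (by positivity)
    (by rw [div_le_one uT]; linarith) ?_ ?_ ?_ ?_
    (hA (r * x * (t₂ - t₀) / (t₂ - t₁)) (by positivity))
    (hC (r * y * (t₂ - t₀) / (t₁ - t₀)) (by positivity))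
  · rw [hB r (by positivity)] at this
    simp at this
  · field_simp
    linear_combination (-(t₂ - t₀)) * hr2
  · rw [hf]; field_simp; ring
  · rw [hg]; field_simp; ring
  · field_simp; ring

lemma along_line (hE : IsMonotoneColoring E) {a b τ p q s₀ s₁ s₂ : ℝ} {e : Bool}
    (h : a * q - p * b = 1) (h01 : s₀ < s₁) (h12 : s₁ < s₂)
    (h₀ : E (a + s₀ * p, b + s₀ * q, τ + s₀) = e) (h₂ : E (a + s₂ * p, b + s₂ * q, τ + s₂) = e) :
    E (a + s₁ * p, b + s₁ * q, τ + s₁) = e := by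
  have hpos : 0 < s₂ - s₀ := by linarith
  refine hE.mid ((s₁ - s₀) / (s₂ - s₀)) (div_nonneg (by linarith) (by linarith))
    (by rw [div_le_one hpos]; linarith) ?_ ?_ ?_ ?_ h₀ h₂
  · linear_combination (s₀ - s₂) * h
  · field_simp; ring
  · field_simp; ring
  · field_simp; ring

lemma constant_on_halfPlanes (hE : IsMonotoneColoring E) {t₀ t₁ t₂ : ℝ} {e : Bool} (h01 : t₀ < t₁)
    (h12 : t₁ < t₂) (h0 : E (0, 0, t₀) = e) (h1 : E (0, 0, t₁) = !e) (h2 : E (0, 0, t₂) = e) :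
    ∃ α β : ℝ, (α ≠ 0 ∨ β ≠ 0) ∧ ∀ a b τ, (0 < α * a + β * b → E (a, b, τ) = e) ∧
      (α * a + β * b < 0 → E (a, b, τ) = !e) := by
  obtain ⟨α, β, hαβ, H⟩ := (hE.directionTriple h01 h12 h0 h1 h2).split
  have F0 : ∀ {a b τ : ℝ}, τ = t₀ → 0 < α * a + β * b → E (a, b, τ) = e := by
    rintro a b τ rfl h
    simpa using (H a b h).1 1 zero_le_one
  have F2 : ∀ {a b τ : ℝ}, τ = t₂ → 0 < α * a + β * b → E (a, b, τ) = e := by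
    rintro a b τ rfl h
    simpa using (H a b h).2.1 1 zero_le_one
  have F1 : ∀ {a b τ : ℝ}, τ = t₁ → α * a + β * b < 0 → E (a, b, τ) = !e := by
    rintro a b τ rfl h
    simpa using (H (-a) (-b) (by linarith)).2.2 1 zero_le_one
  have line : ∀ (a b κ : ℝ), α * a + β * b ≠ 0 →
      ∃ p q, a * q - p * b = 1 ∧ ∀ s, α * (a + s * p) + β * (b + s * q) = α * a + β * b + s * κ := by
    intro a b κ h
    refine ⟨(a * κ - β) / (α * a + β * b), (b * κ + α) / (α * a + β * b), ?_, fun s => ?_⟩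
    · rw [← div_self h]; ring
    · have : α * ((a * κ - β) / (α * a + β * b)) + β * ((b * κ + α) / (α * a + β * b)) = κ := by
        linear_combination κ * mul_inv_cancel₀ h
      linear_combination s * this
  have pos : ∀ a b τ, 0 < α * a + β * b → E (a, b, τ) = e := by
    intro a b τ h
    suffices H : ∃ κ, ∀ p q, a * q - p * b = 1 →
        (∀ s, α * (a + s * p) + β * (b + s * q) = α * a + β * b + s * κ) →
        E (a + 0 * p, b + 0 * q, τ + 0) = e by
      obtain ⟨κ, hκ⟩ := H
      obtain ⟨p, q, hpq, hκ'⟩ := line a b κ h.ne'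
      simpa using hκ p q hpq hκ'
    rcases lt_or_ge τ t₀ with hτ | hτ
    · have hd : 0 < (t₀ - τ) + (t₁ - τ) := by linarith
      refine ⟨-(2 * (α * a + β * b)) / ((t₀ - τ) + (t₁ - τ)), fun p q hpq hκ => ?_⟩
      by_contra hne
      rw [← ne_eq, ← Bool.eq_not] at hne
      have h3 := hE.along_line hpq (s₀ := 0) (s₁ := t₀ - τ) (s₂ := t₁ - τ) (by linarith)
        (by linarith) hne (F1 (by ring) ?_)
      · rw [F0 (by ring) ?_] at h3
        · simp at h3
        · rw [hκ]
          have : α * a + β * b + (t₀ - τ) * (-(2 * (α * a + β * b)) / (t₀ - τ + (t₁ - τ))) =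
            (α * a + β * b) * (t₁ - t₀) / (t₀ - τ + (t₁ - τ)) := by field_simp; ring
          rw [this]
          have := sub_pos.2 h01
          positivity
      · rw [hκ]
        have : α * a + β * b + (t₁ - τ) * (-(2 * (α * a + β * b)) / (t₀ - τ + (t₁ - τ))) =
          -((α * a + β * b) * (t₁ - t₀) / (t₀ - τ + (t₁ - τ))) := by field_simp; ring
        rw [this]
        have := sub_pos.2 h01
        exact neg_neg_of_pos (by positivity)
    rcases lt_or_ge t₂ τ with hτ' | hτ'
    · have hd : 0 < (τ - t₂) + (τ - t₁) := by linarith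
      refine ⟨(2 * (α * a + β * b)) / ((τ - t₂) + (τ - t₁)), fun p q hpq hκ => ?_⟩
      by_contra hne
      rw [← ne_eq, ← Bool.eq_not] at hne
      have h3 := hE.along_line hpq (s₀ := t₁ - τ) (s₁ := t₂ - τ) (s₂ := 0) (by linarith)
        (by linarith) (F1 (by ring) ?_) hne
      · rw [F2 (by ring) ?_] at h3
        · simp at h3
        · rw [hκ]
          have : α * a + β * b + (t₂ - τ) * ((2 * (α * a + β * b)) / ((τ - t₂) + (τ - t₁))) =
            (α * a + β * b) * (t₂ - t₁) / ((τ - t₂) + (τ - t₁)) := by field_simp; ring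
          rw [this]
          have := sub_pos.2 h12
          positivity
      · rw [hκ]
        have : α * a + β * b + (t₁ - τ) * ((2 * (α * a + β * b)) / ((τ - t₂) + (τ - t₁))) =
          -((α * a + β * b) * (t₂ - t₁) / ((τ - t₂) + (τ - t₁))) := by field_simp; ring
        rw [this]
        have := sub_pos.2 h12
        exact neg_neg_of_pos (by positivity)
    · refine ⟨0, fun p q hpq hκ => ?_⟩
      rcases hτ.eq_or_lt with rfl | hτ
      · exact F0 (by ring) (by simpa using h)
      rcases hτ'.eq_or_lt with rfl | hτ'
      · exact F2 (by ring) (by simpa using h)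
      exact hE.along_line hpq (s₀ := t₀ - τ) (s₂ := t₂ - τ) (by linarith) (by linarith)
        (F0 (by ring) (by rw [hκ]; linarith)) (F2 (by ring) (by rw [hκ]; linarith))
  refine ⟨α, β, hαβ, fun a b τ => ⟨pos a b τ, fun h => ?_⟩⟩
  rcases lt_trichotomy τ t₁ with hτ | hτ | hτ
  · obtain ⟨p, q, hpq, hκ⟩ := line a b (-(α * a + β * b) / ((t₁ - τ) + 1 / 2)) h.ne
    have hd : 0 < (t₁ - τ) + 1 / 2 := by linarith
    by_contra hne
    rw [← ne_eq, ← Bool.eq_not, Bool.not_not] at hne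
    have h3 := hE.along_line hpq (s₀ := 0) (s₁ := t₁ - τ) (s₂ := t₁ - τ + 1) (by linarith)
        (by linarith) (by simpa using hne) (pos _ _ _ ?_)
    · rw [F1 (by ring) ?_] at h3
      · simp at h3
      · rw [hκ]
        have : α * a + β * b + (t₁ - τ) * (-(α * a + β * b) / ((t₁ - τ) + 1 / 2)) =
          (α * a + β * b) / (2 * ((t₁ - τ) + 1 / 2)) := by field_simp; ring
        rw [this]
        exact div_neg_of_neg_of_pos h (by positivity)
    · rw [hκ]
      have : α * a + β * b + (t₁ - τ + 1) * (-(α * a + β * b) / ((t₁ - τ) + 1 / 2)) =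
          -(α * a + β * b) / (2 * ((t₁ - τ) + 1 / 2)) := by field_simp; ring
      rw [this]
      exact div_pos (by linarith) (by positivity)
  · exact F1 hτ h
  · obtain ⟨p, q, hpq, hκ⟩ := line a b ((α * a + β * b) / ((τ - t₁) + 1 / 2)) h.ne
    have hd : 0 < (τ - t₁) + 1 / 2 := by linarith
    by_contra hne
    rw [← ne_eq, ← Bool.eq_not, Bool.not_not] at hne
    have h3 := hE.along_line hpq (s₀ := t₁ - τ - 1) (s₁ := t₁ - τ) (s₂ := 0) (by linarith)
        (by linarith) (pos _ _ _ ?_) (by simpa using hne)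
    · rw [F1 (by ring) ?_] at h3
      · simp at h3
      · rw [hκ]
        have : α * a + β * b + (t₁ - τ) * ((α * a + β * b) / ((τ - t₁) + 1 / 2)) =
          (α * a + β * b) / (2 * ((τ - t₁) + 1 / 2)) := by field_simp; ring
        rw [this]
        exact div_neg_of_neg_of_pos h (by positivity)
    · rw [hκ]
      have : α * a + β * b + (t₁ - τ - 1) * ((α * a + β * b) / ((τ - t₁) + 1 / 2)) =
          -(α * a + β * b) / (2 * ((τ - t₁) + 1 / 2)) := by field_simp; ring
      rw [this]
      exact div_pos (by linarith) (by positivity)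

/-- A monotone colouring which is not monotone on a vertical line is constant on each side of
some vertical plane through that line. -/
theorem exists_halfPlanes (hE : IsMonotoneColoring E) {x y t₀ t₁ t₂ : ℝ} (h01 : t₀ ≤ t₁)
    (h12 : t₁ ≤ t₂) (h02 : E (x, y, t₀) = E (x, y, t₂)) (hne : E (x, y, t₁) ≠ E (x, y, t₀)) :
    ∃ (α β : ℝ) (e : Bool), (α ≠ 0 ∨ β ≠ 0) ∧ ∀ a b τ,
      (0 < α * (a - x) + β * (b - y) → E (a, b, τ) = e) ∧
      (α * (a - x) + β * (b - y) < 0 → E (a, b, τ) = !e) := by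
  have h01' : t₀ < t₁ := h01.lt_of_ne (by rintro rfl; exact hne rfl)
  have h12' : t₁ < t₂ := h12.lt_of_ne (by rintro rfl; exact hne h02.symm)
  have e0 : ∀ t, symMul (x, y, 0) (0, 0, t) = (x, y, t) := fun t => by simp [symMul]
  obtain ⟨α, β, h, H⟩ := (hE.translate (x, y, 0)).constant_on_halfPlanes h01' h12'
    (e := E (x, y, t₀)) (by simp only [e0]) (by rw [Bool.eq_not]; simpa only [e0] using hne)
    (by simp only [e0, h02])
  refine ⟨α, β, E (x, y, t₀), h, fun a b τ => ?_⟩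
  have := H (a - x) (b - y) (τ - (x * (b - y) - (a - x) * y))
  simpa [symMul] using this

end IsMonotoneColoring

/-- The cut semimetric of a two-colouring. -/
def cut {X : Type*} (E : X → Bool) (p q : X) : ℝ := if E p = E q then 0 else 1

/-- The sum of a function of two variables against a finitely supported weight. -/
def pairing {X : Type*} (ρ : X → X → ℝ) : (X × X →₀ ℝ) →ₗ[ℝ] ℝ :=
  Finsupp.linearCombination ℝ fun p => ρ p.1 p.2

/-- The functions of two variables satisfying every linear inequality which holds for all cut
semimetrics. -/
def CutCone {X : Type*} (ρ : X → X → ℝ) : Prop :=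
  ∀ w, (∀ E, 0 ≤ pairing (cut E) w) → 0 ≤ pairing ρ w

section CutCone

variable {X : Type*} {ρ : X → X → ℝ}

@[simp]
lemma pairing_single (ρ : X → X → ℝ) (p q : X) (r : ℝ) :
    pairing ρ (Finsupp.single (p, q) r) = r * ρ p q := by
  simp [pairing]

lemma pairing_apply (ρ : X → X → ℝ) (w : X × X →₀ ℝ) :
    pairing ρ w = ∑ p ∈ w.support, w p * ρ p.1 p.2 := rfl

@[simp]
lemma cut_self (E : X → Bool) (p : X) : cut E p p = 0 := by simp [cut]

lemma cut_comm (E : X → Bool) (p q : X) : cut E p q = cut E q p := by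
  simp [cut, eq_comm]

lemma cut_nonneg (E : X → Bool) (p q : X) : 0 ≤ cut E p q := by
  unfold cut; split_ifs <;> norm_num

lemma cut_le_one (E : X → Bool) (p q : X) : cut E p q ≤ 1 := by
  unfold cut; split_ifs <;> norm_num

lemma cut_triangle (E : X → Bool) (p q r : X) : cut E p r ≤ cut E p q + cut E q r := by
  unfold cut; cases E p <;> cases E q <;> cases E r <;> norm_num

namespace CutCone

lemma self (h : CutCone ρ) (p : X) : ρ p p = 0 := by
  have h1 := h (Finsupp.single (p, p) 1) (by simp)
  have h2 := h (Finsupp.single (p, p) (-1)) (by simp)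
  simp at h1 h2
  linarith

lemma nonneg (h : CutCone ρ) (p q : X) : 0 ≤ ρ p q := by
  simpa using h (Finsupp.single (p, q) 1) (by simp [cut_nonneg])

lemma comm (h : CutCone ρ) (p q : X) : ρ p q = ρ q p := by
  have H : ∀ p q, ρ p q ≤ ρ q p := fun p q => by
    have := h (Finsupp.single (q, p) 1 - Finsupp.single (p, q) 1)
      fun E => by simp [cut_comm E p q]
    simpa using this
  exact le_antisymm (H p q) (H q p)

lemma triangle (h : CutCone ρ) (p q r : X) : ρ p r ≤ ρ p q + ρ q r := by
  have := h (Finsupp.single (p, q) 1 + Finsupp.single (q, r) 1 - Finsupp.single (p, r) 1)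
    fun E => by simp [cut_triangle]
  simpa using this

lemma comp (h : CutCone ρ) {X' : Type*} (g : X' → X) : CutCone fun p q => ρ (g p) (g q) := by
  have key : ∀ (σ : X → X → ℝ) (w : X' × X' →₀ ℝ),
      pairing σ (w.mapDomain (Prod.map g g)) = pairing (fun p q => σ (g p) (g q)) w := by
    intro σ w
    simp only [pairing, Finsupp.linearCombination_mapDomain]
    rfl
  intro w hw
  rw [← key]
  refine h _ fun E => ?_
  rw [key]
  exact hw fun x => E (g x)

lemma smul (h : CutCone ρ) {r : ℝ} (hr : 0 ≤ r) : CutCone fun p q => r * ρ p q := by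
  intro w hw
  have : pairing (fun p q => r * ρ p q) w = r * pairing ρ w := by
    simp only [pairing_apply, Finset.mul_sum]
    exact Finset.sum_congr rfl fun _ _ => by ring
  rw [this]
  exact mul_nonneg hr (h w hw)

lemma sum {ι : Type*} (s : Finset ι) {ρ : ι → X → X → ℝ} (h : ∀ i ∈ s, CutCone (ρ i)) :
    CutCone fun p q => ∑ i ∈ s, ρ i p q := by
  intro w hw
  have : pairing (fun p q => ∑ i ∈ s, ρ i p q) w = ∑ i ∈ s, pairing (ρ i) w := by
    simp only [pairing_apply, Finset.mul_sum]
    exact Finset.sum_comm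
  rw [this]
  exact Finset.sum_nonneg fun i hi => h i hi w hw

lemma of_tendsto {ι : Type*} {l : Filter ι} [l.NeBot] {ρn : ι → X → X → ℝ}
    (h : ∀ i, CutCone (ρn i)) (hlim : ∀ p q, Tendsto (fun i => ρn i p q) l (𝓝 (ρ p q))) :
    CutCone ρ := by
  intro w hw
  refine ge_of_tendsto' (x := l) (f := fun i => pairing (ρn i) w) ?_ fun i => h i w hw
  simp only [pairing_apply]
  exact tendsto_finsetSum _ fun p _ => (hlim _ _).const_mul _

lemma of_real (f : X → ℝ) : CutCone fun p q => |f p - f q| := by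
  intro w hw
  have hcut : ∀ p q, (fun s => cut (fun x => decide (s < f x)) p q) =
      (Ico (min (f p) (f q)) (max (f p) (f q))).indicator fun _ => 1 := by
    intro p q
    ext s
    simp only [cut, indicator, mem_Ico, min_le_iff, lt_max_iff, decide_eq_decide]
    by_cases h1 : s < f p <;> by_cases h2 : s < f q <;> simp [h1, h2, not_lt.1]
  have hint : ∀ p q, Integrable (fun s => cut (fun x => decide (s < f x)) p q) := fun p q => by
    rw [hcut, integrable_indicator_iff measurableSet_Ico]
    exact integrableOn_const (by simp)
  have heq : ∀ p q, |f p - f q| = ∫ s, cut (fun x => decide (s < f x)) p q := fun p q => by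
    rw [hcut, integral_indicator measurableSet_Ico]
    simp [max_sub_min_eq_abs, abs_sub_comm]
  have : pairing (fun p q => |f p - f q|) w =
      ∫ s, pairing (cut fun x => decide (s < f x)) w := by
    simp only [pairing_apply, heq]
    rw [integral_finsetSum _ fun p _ => (hint _ _).const_mul _]
    simp only [integral_const_mul]
  rw [this]
  exact integral_nonneg fun s => hw _

lemma of_Lp {Y : Type*} [MeasurableSpace Y] {ν : Measure Y} (F : X → Lp ℝ 1 ν) :
    CutCone fun p q => ‖F p - F q‖ := by
  intro w hw
  have hint : ∀ p q, Integrable (fun y => |F p y - F q y|) ν := fun p q =>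
    ((L1.integrable_coeFn (F p)).sub (L1.integrable_coeFn (F q))).abs
  have heq : ∀ p q, ‖F p - F q‖ = ∫ y, |F p y - F q y| ∂ν := fun p q => by
    rw [L1.norm_eq_integral_norm]
    refine integral_congr_ae ?_
    filter_upwards [Lp.coeFn_sub (F p) (F q)] with y hy
    rw [hy, Pi.sub_apply, Real.norm_eq_abs]
  have : pairing (fun p q => ‖F p - F q‖) w =
      ∫ y, pairing (fun p q => |F p y - F q y|) w ∂ν := by
    simp only [pairing_apply, heq]
    rw [integral_finsetSum _ fun p _ => (hint _ _).const_mul _]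
    simp only [integral_const_mul]
  rw [this]
  exact integral_nonneg fun y => of_real (fun p => F p y) w hw

/-- A linear inequality satisfied by all colourings which are monotone along a family `T` of
triples holds for every element of the cut cone which is additive along `T`. -/
theorem pairing_nonneg_of_monotone (h : CutCone ρ) (T : Set (X × X × X))
    (hT : ∀ t ∈ T, ρ t.1 t.2.1 + ρ t.2.1 t.2.2 = ρ t.1 t.2.2) (w : X × X →₀ ℝ)
    (hw : ∀ E : X → Bool, (∀ t ∈ T, E t.1 = E t.2.2 → E t.2.1 = E t.1) → 0 ≤ pairing (cut E) w) :
    0 ≤ pairing ρ w := by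
  have hloc2 : ∀ p q, IsLocallyConstant fun E : X → Bool => decide (E p = E q) := fun p q => by
    rw [IsLocallyConstant.iff_continuous]
    have hc : Continuous fun b : Bool × Bool => decide (b.1 = b.2) :=
      continuous_of_discreteTopology
    have hp : ∀ p, Continuous fun E : X → Bool => E p := fun p => continuous_apply p
    exact hc.comp ((hp p).prodMk (hp q))
  have hloc : ∀ w : X × X →₀ ℝ, IsLocallyConstant fun E : X → Bool => pairing (cut E) w := by
    intro w
    induction w using Finsupp.induction_linear with
    | zero => simpa using IsLocallyConstant.of_constant _ fun _ _ => rfl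
    | add f g hf hg =>
      simp only [map_add]
      exact hf.add hg
    | single p r =>
      convert (hloc2 p.1 p.2).comp fun b => r * if b then 0 else 1 using 2 with E
      simp [pairing, cut]
  have hcl : IsClosed {E : X → Bool | pairing (cut E) w < 0} := by
    rw [← isOpen_compl_iff]
    exact hloc w {x | ¬ x < 0}
  have hcl' : ∀ t : T, IsClosed {E : X → Bool | E t.1.1 = E t.1.2.2 → E t.1.2.1 = E t.1.1} := by
    intro t
    simp only [imp_iff_not_or]
    refine IsClosed.union (s₁ := {E : X → Bool | ¬ E t.1.1 = E t.1.2.2}) ?_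
      (isClosed_eq (continuous_apply _) (continuous_apply _))
    rw [← isOpen_compl_iff]
    convert hloc2 t.1.1 t.1.2.2 {true} using 1
    ext E
    simp
  obtain ⟨u, hu⟩ := IsCompact.elim_finite_subfamily_closed hcl.isCompact _ hcl' (by
    ext E
    simp only [mem_inter_iff, mem_ofPred_eq, mem_iInter, mem_empty_iff_false, iff_false, not_and]
    intro h1 h2
    exact absurd (hw E fun t ht => h2 ⟨t, ht⟩) h1.not_ge)
  set K := ∑ p ∈ w.support, |w p| with hK
  have hK0 : 0 ≤ K := Finset.sum_nonneg fun _ _ => abs_nonneg _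
  have hKle : ∀ E : X → Bool, -K ≤ pairing (cut E) w := by
    intro E
    rw [pairing_apply, hK, ← Finset.sum_neg_distrib]
    refine Finset.sum_le_sum fun p _ => ?_
    have h1 := cut_nonneg E p.1 p.2
    have h2 := cut_le_one E p.1 p.2
    nlinarith [neg_abs_le (w p), abs_nonneg (w p)]
  set v : T → X × X →₀ ℝ := fun t => Finsupp.single (t.1.1, t.1.2.1) 1 +
    Finsupp.single (t.1.2.1, t.1.2.2) 1 - Finsupp.single (t.1.1, t.1.2.2) 1 with hv
  have hvE : ∀ (E : X → Bool) t, 0 ≤ pairing (cut E) (v t) := fun E t => by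
    simp only [hv, map_add, map_sub, pairing_single, one_mul, sub_nonneg]
    exact cut_triangle E _ _ _
  have key := h (w + K • ∑ t ∈ u, v t) fun E => by
    simp only [map_add, map_smul, map_sum, smul_eq_mul]
    have hs : 0 ≤ ∑ t ∈ u, pairing (cut E) (v t) := Finset.sum_nonneg fun t _ => hvE E t
    by_cases hE : 0 ≤ pairing (cut E) w
    · positivity
    · have : ∃ t ∈ u, ¬ (E t.1.1 = E t.1.2.2 → E t.1.2.1 = E t.1.1) := by
        by_contra! hc
        have : E ∈ (∅ : Set (X → Bool)) := by
          rw [← hu]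
          simp only [mem_inter_iff, mem_ofPred_eq, mem_iInter]
          exact ⟨not_le.1 hE, hc⟩
        exact this
      obtain ⟨t, htu, ht⟩ := this
      have h1 : 1 ≤ pairing (cut E) (v t) := by
        push Not at ht
        simp only [hv, map_add, map_sub, pairing_single, one_mul, cut]
        rw [if_neg (Ne.symm ht.2), if_neg (ht.1 ▸ ht.2), if_pos ht.1]
        norm_num
      have h2 := Finset.single_le_sum (fun t _ => hvE E t) htu
      nlinarith [hKle E]
  have h0 : ∀ t, pairing ρ (v t) = 0 := fun t => by
    simp only [hv, map_add, map_sub, pairing_single, one_mul, hT t.1 t.2, sub_self]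
  simpa [h0] using key

end CutCone

end CutCone

/-- The change of coordinates from those of `symMul` to those of `hMul`. -/
def toHeis (P : Heis) : Heis := (P.1, P.2.1, (P.2.2 + P.1 * P.2.1) / 2)

/-- A left-invariant homogeneous quasi-distance, in the coordinates of `symMul`. -/
def quasiDist (P Q : Heis) : ℝ :=
  |Q.1 - P.1| + |Q.2.1 - P.2.1| + √|Q.2.2 - P.2.2 - (P.1 * Q.2.1 - Q.1 * P.2.1)|

lemma hasDerivAt_of_degree_le_seven (k₀ k₁ k₂ k₃ k₄ k₅ k₆ k₇ t : ℝ) :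
    HasDerivAt (fun t => k₀ + k₁ * t + k₂ * t ^ 2 + k₃ * t ^ 3 + k₄ * t ^ 4 + k₅ * t ^ 5 +
      k₆ * t ^ 6 + k₇ * t ^ 7)
      (k₁ + 2 * k₂ * t + 3 * k₃ * t ^ 2 + 4 * k₄ * t ^ 3 + 5 * k₅ * t ^ 4 + 6 * k₆ * t ^ 5 +
      7 * k₇ * t ^ 6) t := by
  have h := fun (n : ℕ) (k : ℝ) => (hasDerivAt_pow n t).const_mul k
  refine ((((((((hasDerivAt_const t k₀).add ((hasDerivAt_id t).const_mul k₁)).add (h 2 k₂)).add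
    (h 3 k₃)).add (h 4 k₄)).add (h 5 k₅)).add (h 6 k₆)).add (h 7 k₇)).congr_deriv ?_
  norm_num
  ring

lemma bddBelow_lengths (x y : Heis) :
    BddBelow { l : ℝ | ∃ c : ℝ → Heis, ∃ v₁ v₂ : ℝ → ℝ,
    (∃ K : NNReal, LipschitzOnWith K c (Icc 0 1)) ∧
    IsHorizPath c v₁ v₂ ∧
    IntervalIntegrable (fun t => Real.sqrt (v₁ t ^ 2 + v₂ t ^ 2)) volume 0 1 ∧
    c 0 = x ∧ c 1 = y ∧ l = pathLen v₁ v₂ } := by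
  refine ⟨0, ?_⟩
  rintro l ⟨c, v₁, v₂, -, -, -, -, -, rfl⟩
  exact intervalIntegral.integral_nonneg zero_le_one fun t _ => Real.sqrt_nonneg _

lemma exists_mul_eq_of_sqrt (κ : ℝ) :
    ∃ A B : ℝ, A * B = 175 * κ ∧ |A| ≤ 14 * √|κ| ∧ |B| ≤ 14 * √|κ| := by
  have h0 := Real.sqrt_nonneg |κ|
  have hs := Real.mul_self_sqrt (abs_nonneg κ)
  rcases le_total 0 κ with h | h
  · rw [abs_of_nonneg h] at *
    exact ⟨14 * √κ, 25 / 2 * √κ, by linear_combination 175 * hs,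
      by rw [abs_of_nonneg (by positivity)], by rw [abs_of_nonneg (by positivity)]; linarith⟩
  · rw [abs_of_nonpos h] at *
    refine ⟨14 * √(-κ), -(25 / 2 * √(-κ)), by linear_combination -175 * hs,
      by rw [abs_of_nonneg (by positivity)], ?_⟩
    rw [abs_neg, abs_of_nonneg (by positivity)]
    linarith

lemma exists_horizPath (P Q : Heis) :
    ∃ c : ℝ → Heis, ∃ v₁ v₂ : ℝ → ℝ,
    (∃ K : NNReal, LipschitzOnWith K c (Icc 0 1)) ∧
    IsHorizPath c v₁ v₂ ∧
    IntervalIntegrable (fun t => Real.sqrt (v₁ t ^ 2 + v₂ t ^ 2)) volume 0 1 ∧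
    c 0 = toHeis P ∧ c 1 = toHeis Q ∧ pathLen v₁ v₂ ≤ 28 * quasiDist P Q := by
  obtain ⟨x, y, τ⟩ := P
  obtain ⟨x', y', τ'⟩ := Q
  obtain ⟨A, B, hAB, hA, hB⟩ := exists_mul_eq_of_sqrt (τ' - τ - (x * y' - x' * y))
  set a := x' - x with ha
  set b := y' - y with hb
  set g : ℝ → ℝ := fun t => t - 3 * t ^ 2 + 2 * t ^ 3 with hg
  set g' : ℝ → ℝ := fun t => 1 - 6 * t + 6 * t ^ 2 with hg'
  set h : ℝ → ℝ := fun t => t ^ 2 - 2 * t ^ 3 + t ^ 4 - (t - t ^ 2) / 5 with hh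
  set h' : ℝ → ℝ := fun t => 2 * t - 6 * t ^ 2 + 4 * t ^ 3 - (1 - 2 * t) / 5 with hh'
  set G : ℝ → ℝ := fun t => t ^ 2 * (1 - t) ^ 2 / 2 with hG
  set H : ℝ → ℝ := fun t => t ^ 3 / 3 - t ^ 4 / 2 + t ^ 5 / 5 - t ^ 2 / 10 + t ^ 3 / 15 with hH
  set W : ℝ → ℝ := fun t => 2 * (t ^ 3 / 3 - 6 * t ^ 4 / 4 + 13 * t ^ 5 / 5 - 2 * t ^ 6 +
    4 * t ^ 7 / 7) - 1 / 5 * (t ^ 2 / 2 - 5 * t ^ 3 / 3 + 2 * t ^ 4 - 4 * t ^ 5 / 5) with hW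
  have dg : ∀ t, HasDerivAt g (g' t) t := fun t => by
    convert hasDerivAt_of_degree_le_seven 0 1 (-3) 2 0 0 0 0 t using 1
    · ext s; simp only [hg]; ring
    · simp only [hg']; ring
  have dh : ∀ t, HasDerivAt h (h' t) t := fun t => by
    convert hasDerivAt_of_degree_le_seven 0 (-1 / 5) (6 / 5) (-2) 1 0 0 0 t using 1
    · ext s; simp only [hh]; ring
    · simp only [hh']; ring
  have dG : ∀ t, HasDerivAt G (g t) t := fun t => by
    convert hasDerivAt_of_degree_le_seven 0 0 (1 / 2) (-1) (1 / 2) 0 0 0 t using 1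
    · ext s; simp only [hG]; ring
    · simp only [hg]; ring
  have dH : ∀ t, HasDerivAt H (h t) t := fun t => by
    convert hasDerivAt_of_degree_le_seven 0 0 (-1 / 10) (2 / 5) (-1 / 2) (1 / 5) 0 0 t using 1
    · ext s; simp only [hH]; ring
    · simp only [hh]; ring
  have dW : ∀ t, HasDerivAt W (g t * h' t) t := fun t => by
    convert hasDerivAt_of_degree_le_seven 0 0 (-1 / 10) 1 (-3 - 2 / 5) (26 / 5 + 4 / 25) (-4)
      (8 / 7) t using 1
    · ext s; simp only [hW]; ring
    · simp only [hg, hh']; ring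
  set c₁ : ℝ → ℝ := fun t => x + a * t + A * g t with hc₁
  set c₂ : ℝ → ℝ := fun t => y + b * t + B * h t with hc₂
  set c₃ : ℝ → ℝ := fun t => (τ + x * y) / 2 + x * b * t + x * B * h t + a * b / 2 * t ^ 2 +
    a * B * (t * h t - H t) + A * b * G t + A * B * W t with hc₃
  set v₁ : ℝ → ℝ := fun t => a + A * g' t with hv₁
  set v₂ : ℝ → ℝ := fun t => b + B * h' t with hv₂
  have cont : Continuous fun t => √(v₁ t ^ 2 + v₂ t ^ 2) := by
    simp only [hv₁, hv₂, hg', hh']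
    fun_prop
  refine ⟨fun t => (c₁ t, c₂ t, c₃ t), v₁, v₂, ?_, ?_, ?_, ?_, ?_, ?_⟩
  · have : ContDiff ℝ 1 fun t => (c₁ t, c₂ t, c₃ t) := by
      simp only [hc₁, hc₂, hc₃, hg, hh, hG, hH, hW]
      fun_prop
    exact this.contDiffOn.exists_lipschitzOnWith one_ne_zero (convex_Icc 0 1) isCompact_Icc
  · refine Eventually.of_forall fun t _ => ⟨?_, ?_, ?_⟩
    · refine (((hasDerivAt_const t x).add ((hasDerivAt_id t).const_mul a)).add
        ((dg t).const_mul A)).congr_deriv ?_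
      simp only [hv₁]; ring
    · refine (((hasDerivAt_const t y).add ((hasDerivAt_id t).const_mul b)).add
        ((dh t).const_mul B)).congr_deriv ?_
      simp only [hv₂]; ring
    · refine (((((((hasDerivAt_const t ((τ + x * y) / 2)).add
        ((hasDerivAt_id t).const_mul (x * b))).add ((dh t).const_mul (x * B))).add
        ((hasDerivAt_pow 2 t).const_mul (a * b / 2))).add
        ((((hasDerivAt_id t).mul (dh t)).sub (dH t)).const_mul (a * B))).add
        ((dG t).const_mul (A * b))).add ((dW t).const_mul (A * B))).congr_deriv ?_
      simp only [hc₁, hv₂, id]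
      push_cast
      ring
  · exact cont.intervalIntegrable 0 1
  · simp [hc₁, hc₂, hc₃, hg, hh, hG, hH, hW, toHeis]
  · ext
    · simp [hc₁, hg, toHeis, ha]; norm_num
    · simp [hc₂, hh, toHeis, hb]; norm_num
    · simp only [hc₃, hh, hG, hH, hW, toHeis]
      rw [hAB, ha, hb]; ring
  · have hbound : ∀ t ∈ Icc (0 : ℝ) 1, √(v₁ t ^ 2 + v₂ t ^ 2) ≤
        28 * quasiDist (x, y, τ) (x', y', τ') := by
      rintro t ⟨h0, h1⟩
      have bg : |g' t| ≤ 1 := by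
        rw [abs_le]; constructor <;> simp only [hg'] <;> nlinarith [sq_nonneg (2 * t - 1)]
      have bh : |h' t| ≤ 1 := by
        rw [abs_le]
        constructor <;> simp only [hh'] <;>
          nlinarith [mul_nonneg h0 (sub_nonneg.2 h1), mul_nonneg (mul_nonneg h0 (sub_nonneg.2 h1)) h0,
            sq_nonneg (2 * t - 1)]
      have b1 : |v₁ t| ≤ |a| + |A| := by
        refine (abs_add_le _ _).trans ?_
        rw [abs_mul]; nlinarith [abs_nonneg A]
      have b2 : |v₂ t| ≤ |b| + |B| := by
        refine (abs_add_le _ _).trans ?_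
        rw [abs_mul]; nlinarith [abs_nonneg B]
      have b3 : √(v₁ t ^ 2 + v₂ t ^ 2) ≤ |v₁ t| + |v₂ t| := by
        rw [Real.sqrt_le_left (by positivity), ← sq_abs (v₁ t), ← sq_abs (v₂ t)]
        nlinarith [abs_nonneg (v₁ t), abs_nonneg (v₂ t)]
      simp only [quasiDist]
      linarith [abs_nonneg a, abs_nonneg b]
    calc pathLen v₁ v₂ ≤ ∫ _ in (0 : ℝ)..1, 28 * quasiDist (x, y, τ) (x', y', τ') :=
          intervalIntegral.integral_mono_on zero_le_one (cont.intervalIntegrable 0 1)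
            (by simp) hbound
      _ = _ := by simp

lemma ccDist_le_quasiDist (P Q : Heis) :
    ccDist (toHeis P) (toHeis Q) ≤ 28 * quasiDist P Q := by
  obtain ⟨c, v₁, v₂, h1, h2, h3, h4, h5, h6⟩ := exists_horizPath P Q
  exact (csInf_le (bddBelow_lengths _ _) ⟨c, v₁, v₂, h1, h2, h3, h4, h5, rfl⟩).trans h6

lemma abs_sub_le_integral_of_ae_hasDerivAt {f v u : ℝ → ℝ}
    (hf : AbsolutelyContinuousOnInterval f 0 1)
    (hv : ∀ᵐ t ∂(volume : Measure ℝ), t ∈ Icc (0 : ℝ) 1 → HasDerivAt f (v t) t ∧ |v t| ≤ u t)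
    (hu : IntervalIntegrable u volume 0 1) (hu0 : ∀ t, 0 ≤ u t) {t : ℝ} (ht : t ∈ Icc (0 : ℝ) 1) :
    |f t - f 0| ≤ ∫ s in (0 : ℝ)..1, u s := by
  have hsub : uIcc 0 t ⊆ uIcc 0 1 := by
    rw [uIcc_of_le ht.1, uIcc_of_le zero_le_one]
    exact Icc_subset_Icc_right ht.2
  rw [← (hf.mono hsub).integral_deriv_eq_sub, ← Real.norm_eq_abs]
  refine (intervalIntegral.norm_integral_le_of_norm_le (f := deriv f) (g := u) ht.1 ?_
    (hu.mono_set hsub)).trans ?_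
  · filter_upwards [hv] with s hs hs'
    obtain ⟨h1, h2⟩ := hs ⟨hs'.1.le, hs'.2.trans ht.2⟩
    rwa [h1.deriv]
  · exact intervalIntegral.integral_mono_interval le_rfl ht.1 ht.2
      (Eventually.of_forall hu0) hu

lemma sqrt_le_ccDist (P : Heis) (τ : ℝ) :
    √(|τ| / 2) ≤ ccDist (toHeis P) (toHeis (P.1, P.2.1, P.2.2 + τ)) := by
  refine le_csInf ?_ ?_
  · obtain ⟨c, v₁, v₂, h1, h2, h3, h4, h5, -⟩ := exists_horizPath P (P.1, P.2.1, P.2.2 + τ)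
    exact ⟨_, c, v₁, v₂, h1, h2, h3, h4, h5, rfl⟩
  rintro l ⟨c, v₁, v₂, ⟨K, hK⟩, hc, hint, h0, h1, rfl⟩
  obtain ⟨x, y, z⟩ := P
  set L := pathLen v₁ v₂
  have hfst : LipschitzOnWith K (fun t => (c t).1) (uIcc 0 1) := by
    rw [uIcc_of_le zero_le_one]
    simpa [Function.comp_def] using LipschitzWith.prod_fst.comp_lipschitzOnWith hK
  have hsnd : LipschitzOnWith K (fun t => (c t).2) (Icc 0 1) := by
    simpa [Function.comp_def] using LipschitzWith.prod_snd.comp_lipschitzOnWith hK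
  have hsnd1 : LipschitzOnWith K (fun t => (c t).2.1) (uIcc 0 1) := by
    rw [uIcc_of_le zero_le_one]
    simpa [Function.comp_def] using LipschitzWith.prod_fst.comp_lipschitzOnWith hsnd
  have hsnd2 : LipschitzOnWith K (fun t => (c t).2.2) (uIcc 0 1) := by
    rw [uIcc_of_le zero_le_one]
    simpa [Function.comp_def] using LipschitzWith.prod_snd.comp_lipschitzOnWith hsnd
  have ac₁ := hfst.absolutelyContinuousOnInterval
  have ac₂ := hsnd1.absolutelyContinuousOnInterval
  have ac₃ := hsnd2.absolutelyContinuousOnInterval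
  have hL0 : 0 ≤ L := intervalIntegral.integral_nonneg zero_le_one fun t _ => Real.sqrt_nonneg _
  have hdist : ∀ t ∈ Icc (0 : ℝ) 1, |(c t).1 - x| ≤ L := by
    intro t ht
    have := abs_sub_le_integral_of_ae_hasDerivAt (v := v₁) ac₁ (by
      filter_upwards [hc] with s hs hs'
      refine ⟨(hs hs').1, Real.abs_le_sqrt ?_⟩
      linarith [sq_nonneg (v₂ s)]) hint (fun _ => Real.sqrt_nonneg _) ht
    rw [h0] at this
    exact this
  have hle := abs_sub_le_integral_of_ae_hasDerivAt (t := 1) (v := fun t => (c t).1 * v₂ t - x * v₂ t)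
    (ac₃.sub (ac₂.const_mul x)) (by
      filter_upwards [hc] with s hs hs'
      refine ⟨(hs hs').2.2.sub ((hs hs').2.1.const_mul x), ?_⟩
      rw [← sub_mul, abs_mul]
      refine mul_le_mul (hdist s hs') (Real.abs_le_sqrt ?_) (abs_nonneg _) hL0
      linarith [sq_nonneg (v₁ s)]) (hint.const_mul L)
      (fun _ => mul_nonneg hL0 (Real.sqrt_nonneg _)) (by simp)
  rw [intervalIntegral.integral_const_mul] at hle
  change _ ≤ L * L at hle
  simp only [Pi.sub_apply, h0, h1, toHeis] at hle
  rw [Real.sqrt_le_left hL0, ← abs_two, ← abs_div]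
  convert hle using 1 <;> ring_nf

/-- The automorphic dilations of the Heisenberg group. -/
def dilate (r : ℝ) (P : Heis) : Heis := (r * P.1, r * P.2.1, r ^ 2 * P.2.2)

lemma dilate_symMul (r : ℝ) (P Q : Heis) :
    dilate r (symMul P Q) = symMul (dilate r P) (dilate r Q) := by
  ext <;> simp only [dilate, symMul] <;> ring

lemma quasiDist_self (P : Heis) : quasiDist P P = 0 := by
  simp [quasiDist]

lemma quasiDist_symMul (G P Q : Heis) :
    quasiDist (symMul G P) (symMul G Q) = quasiDist P Q := by
  simp only [quasiDist, symMul]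
  congr 3 <;> ring_nf

lemma quasiDist_dilate {r : ℝ} (hr : 0 ≤ r) (P Q : Heis) :
    quasiDist (dilate r P) (dilate r Q) = r * quasiDist P Q := by
  have h : √|r ^ 2 * Q.2.2 - r ^ 2 * P.2.2 - (r * P.1 * (r * Q.2.1) - r * Q.1 * (r * P.2.1))| =
      r * √|Q.2.2 - P.2.2 - (P.1 * Q.2.1 - Q.1 * P.2.1)| := by
    rw [← Real.sqrt_sq hr, ← Real.sqrt_mul (sq_nonneg r), Real.sqrt_sq hr, ← abs_sq r, ← abs_mul]
    congr 2
    rw [abs_sq]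
    ring
  simp only [quasiDist, dilate]
  rw [h, ← mul_sub, ← mul_sub, abs_mul, abs_mul, abs_of_nonneg hr]
  ring

lemma continuous_quasiDist : Continuous fun p : Heis × Heis => quasiDist p.1 p.2 := by
  unfold quasiDist
  fun_prop

/-- Elements of the cut cone comparable to the Carnot–Carathéodory distance, from below only along
vertical lines. -/
structure Good (c C : ℝ) (ρ : Heis → Heis → ℝ) : Prop where
  cutCone : CutCone ρ
  le : ∀ P Q, ρ P Q ≤ C * quasiDist P Q
  ge : ∀ (P : Heis) τ, c * √|τ| ≤ ρ P (P.1, P.2.1, P.2.2 + τ)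

/-- Invariance under a left translation of the Heisenberg group. -/
def LeftInvariant (ρ : Heis → Heis → ℝ) (g : Heis) : Prop :=
  ∀ P Q, ρ (symMul g P) (symMul g Q) = ρ P Q

namespace LeftInvariant

variable {ρ : Heis → Heis → ℝ}

lemma mul {g h : Heis} (hg : LeftInvariant ρ g) (hh : LeftInvariant ρ h) :
    LeftInvariant ρ (symMul g h) := fun P Q => by
  rw [symMul_assoc, symMul_assoc, hg, hh]

lemma neg {a b c : ℝ} (h : LeftInvariant ρ (a, b, c)) : LeftInvariant ρ (-a, -b, -c) := by
  have e : ∀ P, symMul (a, b, c) (symMul (-a, -b, -c) P) = P := fun P => by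
    ext <;> simp only [symMul] <;> ring
  intro P Q
  rw [← h, e, e]

lemma intCast_mul {a b c : ℝ} (h : LeftInvariant ρ (a, b, c)) (k : ℤ) :
    LeftInvariant ρ (k * a, k * b, k * c) := by
  have nat : ∀ k : ℕ, LeftInvariant ρ (k * a, k * b, k * c) := by
    intro k
    induction k with
    | zero => intro P Q; simp [symMul]
    | succ k ih =>
      convert ih.mul h using 1
      ext <;> simp only [symMul] <;> push_cast <;> ring
  obtain ⟨k, rfl | rfl⟩ := k.eq_nat_or_neg
  · simpa using nat k
  · simpa using (nat k).neg

lemma of_generators (hX : LeftInvariant ρ (1, 0, 0)) (hY : LeftInvariant ρ (0, 1, 0))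
    (hZ : LeftInvariant ρ (0, 0, 1)) (i j k : ℤ) : LeftInvariant ρ (i, j, k) := by
  have := ((hX.intCast_mul i).mul (hY.intCast_mul j)).mul (hZ.intCast_mul (k - i * j))
  simpa [symMul] using this

end LeftInvariant

lemma exists_tendsto_hyperfilter {X : Type*} (ρ : ℕ → X → X → ℝ) (B : X → X → ℝ)
    (h : ∀ p q, ∀ᶠ n in atTop, |ρ n p q| ≤ B p q) :
    ∃ ρ' : X → X → ℝ, ∀ p q, Tendsto (fun n => ρ n p q) (hyperfilter ℕ) (𝓝 (ρ' p q)) := by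
  have : ∀ p q, ∃ x, Tendsto (fun n => ρ n p q) (hyperfilter ℕ) (𝓝 x) := by
    intro p q
    have hmem : (((hyperfilter ℕ).map fun n => ρ n p q : Ultrafilter ℝ) : Filter ℝ) ≤
        𝓟 (Icc (-B p q) (B p q)) := by
      rw [le_principal_iff]
      exact Nat.hyperfilter_le_atTop ((h p q).mono fun n hn => abs_le.1 hn)
    obtain ⟨x, -, hx⟩ := isCompact_Icc.ultrafilter_le_nhds _ hmem
    exact ⟨x, hx⟩
  choose ρ' hρ' using this
  exact ⟨ρ', hρ'⟩

lemma exists_good_of_eventually {c C : ℝ} {ρ : ℕ → Heis → Heis → ℝ} (h : ∀ n, CutCone (ρ n))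
    (hle : ∀ P Q, ∀ᶠ n in atTop, ρ n P Q ≤ C * quasiDist P Q)
    (hge : ∀ (P : Heis) τ, ∀ᶠ n in atTop, c * √|τ| ≤ ρ n P (P.1, P.2.1, P.2.2 + τ)) :
    ∃ ρ', Good c C ρ' ∧ ∀ P Q, Tendsto (fun n => ρ n P Q) (hyperfilter ℕ) (𝓝 (ρ' P Q)) := by
  obtain ⟨ρ', hρ'⟩ := exists_tendsto_hyperfilter ρ (fun P Q => C * quasiDist P Q) fun P Q => by
    filter_upwards [hle P Q] with n hn
    rwa [abs_of_nonneg ((h n).nonneg P Q)]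
  exact ⟨ρ', ⟨.of_tendsto h hρ',
    fun P Q => le_of_tendsto (hρ' P Q) (Nat.hyperfilter_le_atTop (hle P Q)),
    fun P τ => ge_of_tendsto (hρ' _ _) (Nat.hyperfilter_le_atTop (hge P τ))⟩, hρ'⟩

namespace Good

variable {c C : ℝ} {ρ : Heis → Heis → ℝ}

lemma exists_blowDown (h : Good c C ρ) : ∃ ρ', Good c C ρ' ∧ ∀ P Q, Tendsto
    (fun n : ℕ => (n.factorial : ℝ)⁻¹ * ρ (dilate n.factorial P) (dilate n.factorial Q))
    (hyperfilter ℕ) (𝓝 (ρ' P Q)) := by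
  have hpos : ∀ n : ℕ, (0 : ℝ) < n.factorial := fun n => by exact_mod_cast n.factorial_pos
  refine exists_good_of_eventually
    (fun n => (h.cutCone.comp (dilate n.factorial)).smul (inv_nonneg.2 (hpos n).le)) ?_ ?_
  · refine fun P Q => Eventually.of_forall fun n => ?_
    rw [inv_mul_le_iff₀ (hpos n)]
    refine (h.le _ _).trans_eq ?_
    rw [quasiDist_dilate (hpos n).le]
    ring
  · refine fun P τ => Eventually.of_forall fun n => ?_
    rw [le_inv_mul_iff₀ (hpos n)]
    have := h.ge (dilate n.factorial P) ((n.factorial : ℝ) ^ 2 * τ)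
    rw [abs_mul, abs_sq, Real.sqrt_mul (sq_nonneg _), Real.sqrt_sq (hpos n).le] at this
    simp only [dilate, mul_add] at this ⊢
    linarith

lemma exists_average (h : Good c C ρ) (a b z : ℝ) : ∃ ρ', Good c C ρ' ∧
    LeftInvariant ρ' (a, b, z) ∧ ∀ g, (∀ (k : ℕ) P Q,
      ρ (symMul (k * a, k * b, k * z) (symMul g P)) (symMul (k * a, k * b, k * z) (symMul g Q)) =
        ρ (symMul (k * a, k * b, k * z) P) (symMul (k * a, k * b, k * z) Q)) →
      LeftInvariant ρ' g := by
  set G : ℕ → Heis := fun k => (k * a, k * b, k * z) with hG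
  set ρn : ℕ → Heis → Heis → ℝ := fun n P Q => ((n : ℝ) + 1)⁻¹ *
    ∑ k ∈ Finset.range (n + 1), ρ (symMul (G k) P) (symMul (G k) Q) with hρn
  have hpos : ∀ n : ℕ, (0 : ℝ) < n + 1 := fun n => by positivity
  obtain ⟨ρ', hρ', hlim⟩ := exists_good_of_eventually (c := c) (C := C) (ρ := ρn)
    (fun n => (CutCone.sum _ fun k _ => h.cutCone.comp (symMul (G k))).smul
      (inv_nonneg.2 (hpos n).le))
    (fun P Q => Eventually.of_forall fun n => by
      rw [hρn, inv_mul_le_iff₀ (hpos n)]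
      have := Finset.sum_le_card_nsmul (Finset.range (n + 1))
        (fun k => ρ (symMul (G k) P) (symMul (G k) Q)) (C * quasiDist P Q) fun k _ => by
          rw [← quasiDist_symMul (G k)]; exact h.le _ _
      simpa using this)
    (fun P τ => Eventually.of_forall fun n => by
      rw [hρn, le_inv_mul_iff₀ (hpos n)]
      have := Finset.card_nsmul_le_sum (Finset.range (n + 1))
        (fun k => ρ (symMul (G k) P) (symMul (G k) (P.1, P.2.1, P.2.2 + τ))) (c * √|τ|)
        fun k _ => by
          have e : symMul (G k) (P.1, P.2.1, P.2.2 + τ) = ((symMul (G k) P).1,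
              (symMul (G k) P).2.1, (symMul (G k) P).2.2 + τ) := by
            simp only [symMul, Prod.mk.injEq, true_and]
            ring
          rw [e]
          exact h.ge _ _
      simpa using this)
  refine ⟨ρ', hρ', fun P Q => ?_, fun g hg P Q => ?_⟩
  · have h0 : Tendsto (fun n => ρn n (symMul (a, b, z) P) (symMul (a, b, z) Q) - ρn n P Q)
        (hyperfilter ℕ) (𝓝 0) := by
      refine Tendsto.mono_left ?_ Nat.hyperfilter_le_atTop
      have hb : ∀ n : ℕ, |ρn n (symMul (a, b, z) P) (symMul (a, b, z) Q) - ρn n P Q| ≤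
          (1 / ((n : ℝ) + 1)) * (C * quasiDist P Q) := by
        intro n
        have e : ρn n (symMul (a, b, z) P) (symMul (a, b, z) Q) - ρn n P Q = ((n : ℝ) + 1)⁻¹ *
            (ρ (symMul (G (n + 1)) P) (symMul (G (n + 1)) Q) - ρ P Q) := by
          have e1 : ∀ k P, symMul (G k) (symMul (a, b, z) P) = symMul (G (k + 1)) P := by
            intro k P
            rw [← symMul_assoc]
            congr 1
            ext <;> simp only [hG, symMul] <;> push_cast <;> ring
          have e2 : ∀ P, symMul (G 0) P = P := fun P => by simp [hG, symMul]
          simp only [hρn, e1, ← mul_sub, ← Finset.sum_sub_distrib]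
          rw [Finset.sum_range_sub fun k => ρ (symMul (G k) P) (symMul (G k) Q), e2, e2]
        rw [e, abs_mul, abs_of_pos (inv_pos.2 (hpos n)), one_div]
        gcongr
        rw [abs_le]
        have h1 := h.cutCone.nonneg P Q
        have h2 := h.cutCone.nonneg (symMul (G (n + 1)) P) (symMul (G (n + 1)) Q)
        have h3 := h.le P Q
        have h4 := h.le (symMul (G (n + 1)) P) (symMul (G (n + 1)) Q)
        rw [quasiDist_symMul] at h4
        constructor <;> linarith
      refine squeeze_zero_norm hb ?_
      simpa using (tendsto_one_div_add_atTop_nhds_zero_nat (𝕜 := ℝ)).mul_const (C * quasiDist P Q)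
    exact sub_eq_zero.1 (tendsto_nhds_unique ((hlim _ _).sub (hlim _ _)) h0)
  · refine tendsto_nhds_unique (hlim _ _) ?_
    have e : ∀ n, ρn n (symMul g P) (symMul g Q) = ρn n P Q := fun n => by
      simp only [hρn]
      congr 1
      exact Finset.sum_congr rfl fun k _ => hg k P Q
    simpa only [e] using hlim P Q

lemma exists_leftInvariant (h : Good c C ρ) :
    ∃ ρ', Good c C ρ' ∧ ∀ i j k : ℤ, LeftInvariant ρ' (i, j, k) := by
  obtain ⟨ρ₁, h₁, hZ₁, -⟩ := h.exists_average 0 0 1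
  obtain ⟨ρ₂, h₂, hY₂, H₂⟩ := h₁.exists_average 0 1 0
  have hZ₂ : LeftInvariant ρ₂ (0, 0, 1) := H₂ _ fun k P Q => by
    rw [← hZ₁ (symMul _ P)]
    simp only [← symMul_assoc]
    congr 2 <;> ext <;> simp only [symMul] <;> ring
  obtain ⟨ρ₃, h₃, hX₃, H₃⟩ := h₂.exists_average 1 0 0
  have hZ₃ : LeftInvariant ρ₃ (0, 0, 1) := H₃ _ fun k P Q => by
    rw [← hZ₂ (symMul _ P)]
    simp only [← symMul_assoc]
    congr 2 <;> ext <;> simp only [symMul] <;> ring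
  have hY₃ : LeftInvariant ρ₃ (0, 1, 0) := H₃ _ fun k P Q => by
    rw [← (hY₂.mul (hZ₂.intCast_mul (2 * k))) (symMul _ P)]
    simp only [← symMul_assoc]
    congr 2 <;> ext <;> simp only [symMul] <;> push_cast <;> ring
  exact ⟨ρ₃, h₃, LeftInvariant.of_generators hX₃ hY₃ hZ₃⟩

lemma continuous (h : Good c C ρ) : Continuous fun p : Heis × Heis => ρ p.1 p.2 := by
  rw [continuous_iff_continuousAt]
  rintro ⟨P, Q⟩
  have hc : Tendsto (fun p : Heis × Heis => C * quasiDist p.1 P + C * quasiDist p.2 Q)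
      (𝓝 (P, Q)) (𝓝 0) := by
    have : Continuous fun p : Heis × Heis => C * quasiDist p.1 P + C * quasiDist p.2 Q :=
      ((continuous_quasiDist.comp (continuous_fst.prodMk continuous_const)).const_mul C).add
        ((continuous_quasiDist.comp (continuous_snd.prodMk continuous_const)).const_mul C)
    simpa [quasiDist_self] using this.tendsto (P, Q)
  rw [ContinuousAt, tendsto_iff_norm_sub_tendsto_zero]
  refine squeeze_zero (fun _ => norm_nonneg _) (fun p => ?_) hc
  have h1 := h.le p.1 P
  have h2 := h.le p.2 Q
  have t1 := h.cutCone.triangle p.1 P p.2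
  have t2 := h.cutCone.triangle P Q p.2
  have t3 := h.cutCone.triangle P p.1 Q
  have t4 := h.cutCone.triangle p.1 p.2 Q
  rw [h.cutCone.comm Q p.2] at t2
  rw [h.cutCone.comm P p.1] at t3
  rw [Real.norm_eq_abs, abs_le]
  constructor <;> simp only <;> linarith

end Good

/-- A sequence of points on vertical lines over distinct points of a parabola. -/
def parabolaPoint (n i k : ℕ) : Heis := (1 / (i + 1), (1 / (i + 1)) ^ 2, k / n)

/-- The corners of a square around the origin. -/
def corner (σ : Bool × Bool) : Heis := (if σ.1 then 3 else -3, if σ.2 then 3 else -3, 0)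

lemma exists_cut_corner {E : Heis → Bool} {x y α β : ℝ} {e : Bool} (hx : |x| ≤ 1) (hy : |y| ≤ 1)
    (h : α ≠ 0 ∨ β ≠ 0) (H : ∀ a b τ,
      (0 < α * (a - x) + β * (b - y) → E (a, b, τ) = e) ∧
      (α * (a - x) + β * (b - y) < 0 → E (a, b, τ) = !e)) :
    ∃ σ σ', cut E (corner σ) (corner σ') = 1 := by
  have pos : ∀ {α x : ℝ}, |x| ≤ 1 → 2 * |α| ≤ α * ((if decide (0 < α) then 3 else -3) - x) := by
    intro α x hx
    rw [abs_le] at hx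
    rcases lt_or_ge 0 α with hα | hα
    · simp only [hα, decide_true, if_true, abs_of_pos hα]; nlinarith
    · simp only [not_lt.2 hα, decide_false, Bool.false_eq_true, if_false, abs_of_nonpos hα]
      nlinarith
  have neg : ∀ {α x : ℝ}, |x| ≤ 1 → α * ((if decide (α ≤ 0) then 3 else -3) - x) ≤ -2 * |α| := by
    intro α x hx
    rw [abs_le] at hx
    rcases lt_or_ge 0 α with hα | hα
    · simp only [not_le.2 hα, decide_false, Bool.false_eq_true, if_false, abs_of_pos hα]
      nlinarith
    · simp only [hα, decide_true, if_true, abs_of_nonpos hα]; nlinarith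
  have hpos : 0 < |α| + |β| := by
    rcases h with h | h <;> positivity
  refine ⟨(decide (0 < α), decide (0 < β)), (decide (α ≤ 0), decide (β ≤ 0)), ?_⟩
  have key : E (corner (decide (0 < α), decide (0 < β))) = e ∧
      E (corner (decide (α ≤ 0), decide (β ≤ 0))) = !e :=
    ⟨(H _ _ _).1 (by linarith [pos (α := α) hx, pos (α := β) hy]),
      (H _ _ _).2 (by linarith [neg (α := α) hx, neg (α := β) hy])⟩
  rw [cut, key.1, key.2]
  simp

lemma sum_cut_le_of_monotone {X : Type*} (E : X → Bool) (p : ℕ → X) (n : ℕ)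
    (h : ∀ m < n, E (p 0) = E (p (m + 1)) → E (p m) = E (p 0)) :
    ∑ k ∈ Finset.range n, cut E (p k) (p (k + 1)) ≤ cut E (p 0) (p n) := by
  induction n with
  | zero => simp
  | succ n ih =>
    rw [Finset.sum_range_succ]
    have h1 := ih fun m hm => h m (by omega)
    have h2 := h n (by omega)
    have : cut E (p 0) (p n) + cut E (p n) (p (n + 1)) ≤ cut E (p 0) (p (n + 1)) := by
      unfold cut
      cases h3 : E (p 0) <;> cases h4 : E (p n) <;> cases h5 : E (p (n + 1)) <;>
        simp_all
    linarith

theorem IsMonotoneColoring.sum_cut_le {E : Heis → Bool} (hE : IsMonotoneColoring E) (n N : ℕ) :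
    ∑ i ∈ Finset.range N, ∑ k ∈ Finset.range n,
      cut E (parabolaPoint n i k) (parabolaPoint n i (k + 1)) ≤
    ∑ i ∈ Finset.range N, cut E (parabolaPoint n i 0) (parabolaPoint n i n) +
      2 * n * ∑ σ, ∑ σ', cut E (corner σ) (corner σ') := by
  set good : ℕ → Prop := fun i => ∀ m < n, E (parabolaPoint n i 0) = E (parabolaPoint n i (m + 1)) →
    E (parabolaPoint n i m) = E (parabolaPoint n i 0) with hgood
  have hbad : ∀ i, ¬ good i → ∃ (α β : ℝ) (e : Bool), (α ≠ 0 ∨ β ≠ 0) ∧ ∀ a b τ,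
      (0 < α * (a - 1 / (i + 1)) + β * (b - (1 / (i + 1)) ^ 2) → E (a, b, τ) = e) ∧
      (α * (a - 1 / (i + 1)) + β * (b - (1 / (i + 1)) ^ 2) < 0 → E (a, b, τ) = !e) := by
    intro i hi
    simp only [hgood, not_forall] at hi
    obtain ⟨m, hm, h1, h2⟩ := hi
    refine hE.exists_halfPlanes ?_ ?_ h1 h2
    · simp only [Nat.cast_zero, zero_div]; positivity
    · gcongr; simp
  classical
  set bad := (Finset.range N).filter fun i => ¬ good i with hbaddef
  have h1 : ∑ i ∈ Finset.range N, ∑ k ∈ Finset.range n,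
      cut E (parabolaPoint n i k) (parabolaPoint n i (k + 1)) ≤
      ∑ i ∈ Finset.range N, (cut E (parabolaPoint n i 0) (parabolaPoint n i n) +
        if ¬ good i then (n : ℝ) else 0) := by
    refine Finset.sum_le_sum fun i _ => ?_
    by_cases hi : good i
    · simpa [hi] using sum_cut_le_of_monotone E (parabolaPoint n i) n hi
    · simp only [hi, not_false_eq_true, if_true]
      have := Finset.sum_le_card_nsmul (Finset.range n)
        (fun k => cut E (parabolaPoint n i k) (parabolaPoint n i (k + 1))) 1
        fun _ _ => cut_le_one _ _ _
      simp only [Finset.card_range, nsmul_eq_mul, mul_one] at this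
      linarith [cut_nonneg E (parabolaPoint n i 0) (parabolaPoint n i n)]
  rw [Finset.sum_add_distrib, ← Finset.sum_filter, Finset.sum_const, nsmul_eq_mul] at h1
  refine h1.trans (add_le_add le_rfl ?_)
  have hQ0 : 0 ≤ ∑ σ, ∑ σ', cut E (corner σ) (corner σ') :=
    Finset.sum_nonneg fun _ _ => Finset.sum_nonneg fun _ _ => cut_nonneg _ _ _
  rcases bad.eq_empty_or_nonempty with h | ⟨i, hi⟩
  · rw [← hbaddef, h]
    simp only [Finset.card_empty, Nat.cast_zero, zero_mul]
    positivity
  · obtain ⟨α, β, e, hαβ, H⟩ := hbad i (Finset.mem_filter.1 hi).2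
    have hx0 : (0 : ℝ) ≤ 1 / (i + 1) := by positivity
    have hx1 : (1 : ℝ) / (i + 1) ≤ 1 := by
      rw [div_le_one (by positivity)]; simp
    have hQ : 1 ≤ ∑ σ, ∑ σ', cut E (corner σ) (corner σ') := by
      obtain ⟨σ, σ', hσ⟩ := exists_cut_corner (by rwa [abs_of_nonneg hx0])
        (by rw [abs_of_nonneg (by positivity)]; exact pow_le_one₀ hx0 hx1) hαβ H
      rw [← hσ]
      refine le_trans ?_ (Finset.single_le_sum (fun σ _ => Finset.sum_nonneg fun σ' _ =>
        cut_nonneg E (corner σ) (corner σ')) (Finset.mem_univ σ))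
      exact Finset.single_le_sum (fun σ' _ => cut_nonneg E (corner σ) (corner σ'))
        (Finset.mem_univ σ')
    have hzero : ∀ j ∈ bad.erase i, β ≠ 0 ∧ α + β * (1 / (i + 1) + 1 / (j + 1)) = 0 := by
      intro j hj
      obtain ⟨hji, hj⟩ := Finset.mem_erase.1 hj
      have hj := (Finset.mem_filter.1 hj).2
      have h0 : α * (1 / (j + 1) - 1 / (i + 1)) +
          β * ((1 / (j + 1)) ^ 2 - (1 / (i + 1)) ^ 2) = 0 := by
        rcases lt_trichotomy (α * (1 / (j + 1) - 1 / (i + 1)) +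
          β * ((1 / (j + 1)) ^ 2 - (1 / (i + 1)) ^ 2)) 0 with h | h | h
        · refine absurd (fun m _ _ => ?_) hj
          simp only [parabolaPoint, (H _ _ _).2 h]
        · exact h
        · refine absurd (fun m _ _ => ?_) hj
          simp only [parabolaPoint, (H _ _ _).1 h]
      have hne : (1 : ℝ) / (j + 1) - 1 / (i + 1) ≠ 0 := by
        rw [sub_ne_zero]
        intro h
        rw [div_eq_div_iff (by positivity) (by positivity)] at h
        apply hji
        have : (i : ℝ) = j := by linarith
        exact_mod_cast this.symm
      have h2 : α + β * (1 / (i + 1) + 1 / (j + 1)) = 0 := by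
        apply (mul_eq_zero.1 (_ : (1 / (j + 1) - 1 / (i + 1) : ℝ) * _ = 0)).resolve_left hne
        linear_combination h0
      refine ⟨?_, h2⟩
      rintro rfl
      simp_all
    have hcard : (bad.erase i).card ≤ 1 := by
      rw [Finset.card_le_one]
      intro j hj k hk
      have h1 := (hzero j hj).2
      have h2 := (hzero k hk).2
      have h3 : (1 : ℝ) / (j + 1) = 1 / (k + 1) := by
        apply mul_left_cancel₀ (hzero j hj).1
        linear_combination h1 - h2
      rw [div_eq_div_iff (by positivity) (by positivity)] at h3
      have : (j : ℝ) = k := by linarith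
      exact_mod_cast this
    have hcard2 : (bad.card : ℝ) ≤ 2 := by
      rw [Finset.card_erase_of_mem hi] at hcard
      have : bad.card ≤ 2 := by omega
      exact_mod_cast this
    have hn : (0 : ℝ) ≤ n := n.cast_nonneg
    calc (bad.card : ℝ) * n ≤ 2 * n * 1 := by nlinarith
      _ ≤ _ := by gcongr

/-- The cut cone contains no semimetric on the Heisenberg group which is bi-Lipschitz to the
Carnot–Carathéodory distance along vertical lines and additive along horizontal lines. -/
theorem not_cutCone_of_additive {ρ : Heis → Heis → ℝ} {c C : ℝ} (hc : 0 < c)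
    (hadd : ∀ (P : Heis) (p q s : ℝ), 0 ≤ s → s ≤ 1 →
      ρ P (symMul P (s * p, s * q, 0)) + ρ (symMul P (s * p, s * q, 0)) (symMul P (p, q, 0)) =
        ρ P (symMul P (p, q, 0)))
    (hle : ∀ P Q, ρ P Q ≤ C * quasiDist P Q)
    (hge : ∀ (P : Heis) τ, c * √|τ| ≤ ρ P (P.1, P.2.1, P.2.2 + τ)) : ¬ CutCone ρ := by
  intro hρ
  obtain ⟨n, hn⟩ := exists_nat_gt (((|C| + 1) / c) ^ 2 + 1)
  have hn0 : (0 : ℝ) < n := lt_trans (by positivity) hn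
  have hn1 : |C| + 1 ≤ n * (c * √(1 / n)) := by
    have h1 : (|C| + 1) / c ≤ √n := Real.le_sqrt_of_sq_le (by linarith)
    rw [div_le_iff₀ hc] at h1
    rw [Real.sqrt_div zero_le_one, Real.sqrt_one]
    have h2 : (n : ℝ) * (c * (1 / √n)) = √n * c := by
      have : √(n : ℝ) ≠ 0 := by positivity
      field_simp
      rw [Real.sq_sqrt hn0.le]
    rwa [h2]
  set M := ∑ σ, ∑ σ', ρ (corner σ) (corner σ') with hM
  obtain ⟨N, hN⟩ := exists_nat_gt (2 * n * M)
  set w : Heis × Heis →₀ ℝ :=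
    ∑ i ∈ Finset.range N, Finsupp.single (parabolaPoint n i 0, parabolaPoint n i n) 1 +
      (2 * n : ℝ) • ∑ σ, ∑ σ', Finsupp.single (corner σ, corner σ') 1 -
      ∑ i ∈ Finset.range N, ∑ k ∈ Finset.range n,
        Finsupp.single (parabolaPoint n i k, parabolaPoint n i (k + 1)) 1 with hw
  have hpair : ∀ σ : Heis → Heis → ℝ, pairing σ w =
      ∑ i ∈ Finset.range N, σ (parabolaPoint n i 0) (parabolaPoint n i n) +
      2 * n * ∑ τ, ∑ τ', σ (corner τ) (corner τ') - ∑ i ∈ Finset.range N, ∑ k ∈ Finset.range n,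
        σ (parabolaPoint n i k) (parabolaPoint n i (k + 1)) := by
    intro σ
    simp only [hw, map_add, map_sub, map_sum, map_smul, pairing_single, one_mul, smul_eq_mul]
  have key := hρ.pairing_nonneg_of_monotone
    {t | ∃ (P : Heis) (p q s : ℝ), 0 ≤ s ∧ s ≤ 1 ∧
      t = (P, symMul P (s * p, s * q, 0), symMul P (p, q, 0))} (by
    rintro _ ⟨P, p, q, s, h0, h1, rfl⟩
    exact hadd P p q s h0 h1) w fun E hE => by
      have hE' : IsMonotoneColoring E := fun P p q s h0 h1 h =>
        hE _ ⟨P, p, q, s, h0, h1, rfl⟩ h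
      rw [hpair]
      linarith [hE'.sum_cut_le n N]
  rw [hpair] at key
  have h1 : ∑ i ∈ Finset.range N, ρ (parabolaPoint n i 0) (parabolaPoint n i n) ≤ N * |C| := by
    have := Finset.sum_le_card_nsmul (Finset.range N)
      (fun i => ρ (parabolaPoint n i 0) (parabolaPoint n i n)) |C| fun i _ => by
        refine (hle _ _).trans ?_
        have : quasiDist (parabolaPoint n i 0) (parabolaPoint n i n) = 1 := by
          simp [quasiDist, parabolaPoint, hn0.ne']
        rw [this, mul_one]
        exact le_abs_self C
    simpa using this
  have h2 : N * (|C| + 1) ≤ ∑ i ∈ Finset.range N, ∑ k ∈ Finset.range n,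
        ρ (parabolaPoint n i k) (parabolaPoint n i (k + 1)) := by
    have := Finset.card_nsmul_le_sum (Finset.range N)
      (fun i => ∑ k ∈ Finset.range n, ρ (parabolaPoint n i k) (parabolaPoint n i (k + 1)))
      (|C| + 1) fun i _ => by
        refine hn1.trans ?_
        have := Finset.card_nsmul_le_sum (Finset.range n)
          (fun k => ρ (parabolaPoint n i k) (parabolaPoint n i (k + 1))) (c * √(1 / n))
          fun k _ => by
            have := hge (parabolaPoint n i k) (1 / n)
            rw [abs_of_nonneg (by positivity)] at this
            have hp : parabolaPoint n i (k + 1) = ((parabolaPoint n i k).1,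
                (parabolaPoint n i k).2.1, (parabolaPoint n i k).2.2 + 1 / n) := by
              simp only [parabolaPoint, Nat.cast_add, Nat.cast_one, add_div]
            rwa [← hp] at this
        simpa using this
    rwa [Finset.card_range, nsmul_eq_mul] at this
  nlinarith

/-- The points of the Heisenberg group with rational coordinates. -/
def ratPoint (a : ℚ × ℚ × ℚ) : Heis := (a.1, a.2.1, a.2.2)

lemma eventually_factorial_mul_eq_intCast (x : ℚ) :
    ∀ᶠ n : ℕ in atTop, ∃ k : ℤ, (n.factorial : ℝ) * x = k := by
  filter_upwards [eventually_ge_atTop x.den] with n hn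
  obtain ⟨m, hm⟩ := Nat.dvd_factorial x.den_pos hn
  refine ⟨m * x.num, ?_⟩
  rw [hm]
  push_cast
  have : ((x.den : ℝ)) * x = x.num := by exact_mod_cast Rat.den_mul_eq_num x
  linear_combination (m : ℝ) * this

namespace Good

variable {c C : ℝ} {ρ : Heis → Heis → ℝ}

lemma exists_tendsto_div (h : Good c C ρ) (hinv : ∀ i j k : ℤ, LeftInvariant ρ (i, j, k))
    (p q : ℤ) : ∃ L, Tendsto (fun k : ℕ => ρ 0 (k * p, k * q, 0) / k) atTop (𝓝 L) := by
  have hsub : Subadditive fun k : ℕ => ρ 0 ((k * p, k * q, 0) : Heis) := fun m n => by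
    have h1 := h.cutCone.triangle 0 ((m * p, m * q, 0) : Heis)
      (((m + n : ℕ) * p, (m + n : ℕ) * q, 0) : Heis)
    have h2 := hinv (m * p) (m * q) 0 0 (n * p, n * q, 0)
    have e1 : symMul (((m * p : ℤ) : ℝ), ((m * q : ℤ) : ℝ), ((0 : ℤ) : ℝ)) 0 =
        ((m * p, m * q, 0) : Heis) := by simp [symMul]
    have e2 : symMul (((m * p : ℤ) : ℝ), ((m * q : ℤ) : ℝ), ((0 : ℤ) : ℝ)) (n * p, n * q, 0) =
        (((m + n : ℕ) * p, (m + n : ℕ) * q, 0) : Heis) := by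
      ext <;> simp only [symMul] <;> push_cast <;> ring
    rw [e1, e2] at h2
    rw [h2] at h1
    exact h1
  refine ⟨hsub.lim, hsub.tendsto_lim ⟨0, ?_⟩⟩
  rintro _ ⟨k, rfl⟩
  exact div_nonneg (h.cutCone.nonneg _ _) k.cast_nonneg

/-- Along a rational direction, a blow-down of an element invariant under the integer lattice is
homogeneous, with a slope which does not depend on the rational base point. -/
lemma exists_slope {ρ' : Heis → Heis → ℝ} (h : Good c C ρ)
    (hinv : ∀ i j k : ℤ, LeftInvariant ρ (i, j, k))
    (hlim : ∀ P Q, Tendsto (fun n : ℕ => (n.factorial : ℝ)⁻¹ *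
      ρ (dilate n.factorial P) (dilate n.factorial Q)) (hyperfilter ℕ) (𝓝 (ρ' P Q)))
    (u v : ℚ) : ∃ L, ∀ (a : ℚ × ℚ × ℚ) (i : ℕ),
      ρ' (ratPoint a) (symMul (ratPoint a) (i * u, i * v, 0)) = i * L := by
  set D : ℕ := u.den * v.den with hD
  have hD0 : 0 < D := Nat.mul_pos u.den_pos v.den_pos
  have hu : (D : ℝ) * u = (u.num * v.den : ℤ) := by
    have : ((u.den : ℝ)) * u = u.num := by exact_mod_cast Rat.den_mul_eq_num u
    rw [hD]; push_cast
    linear_combination (v.den : ℝ) * this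
  have hv : (D : ℝ) * v = (v.num * u.den : ℤ) := by
    have : ((v.den : ℝ)) * v = v.num := by exact_mod_cast Rat.den_mul_eq_num v
    rw [hD]; push_cast
    linear_combination (u.den : ℝ) * this
  obtain ⟨L, hL⟩ := h.exists_tendsto_div hinv (u.num * v.den) (v.num * u.den)
  refine ⟨L / D, fun a i => tendsto_nhds_unique (hlim _ _) ?_⟩
  refine Tendsto.mono_left ?_ Nat.hyperfilter_le_atTop
  obtain rfl | hi := Nat.eq_zero_or_pos i
  · simp [symMul, h.cutCone.self]
  have hdiv : Tendsto (fun n : ℕ => i * (n.factorial / D)) atTop atTop := by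
    refine tendsto_atTop_mono (fun n => Nat.le_mul_of_pos_left _ hi) ?_
    exact (Nat.tendsto_div_const_atTop hD0.ne').comp
      (tendsto_atTop_mono Nat.self_le_factorial tendsto_id)
  have hlim' := (hL.comp hdiv).const_mul ((i : ℝ) / D)
  rw [show (i : ℝ) / D * L = i * (L / D) by ring] at hlim'
  refine hlim'.congr' ?_
  filter_upwards [eventually_factorial_mul_eq_intCast a.1, eventually_ge_atTop D,
    eventually_factorial_mul_eq_intCast a.2.1, eventually_factorial_mul_eq_intCast a.2.2]
    with n ⟨k₁, h₁⟩ hn ⟨k₂, h₂⟩ ⟨k₃, h₃⟩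
  obtain ⟨m, hm⟩ := Nat.dvd_factorial hD0 hn
  have hm0 : 0 < m := by
    rcases Nat.eq_zero_or_pos m with rfl | h
    · exact absurd hm (by simpa using n.factorial_ne_zero)
    · exact h
  have hP : dilate n.factorial (ratPoint a) = ((k₁ : ℝ), (k₂ : ℝ), ((n.factorial * k₃ : ℤ) : ℝ)) := by
    simp only [dilate, ratPoint, h₁, h₂, Prod.mk.injEq, true_and]
    push_cast
    rw [← h₃]; ring
  have hQ : dilate n.factorial (i * u, i * v, 0) =
      (((i * m : ℕ) : ℝ) * (u.num * v.den : ℤ), ((i * m : ℕ) : ℝ) * (v.num * u.den : ℤ), 0) := by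
    simp only [dilate, ← hu, ← hv, hm, Prod.mk.injEq]
    push_cast
    exact ⟨by ring, by ring, by ring⟩
  have key := hinv k₁ k₂ (n.factorial * k₃) 0 (dilate n.factorial (i * u, i * v, 0))
  rw [← hP] at key
  rw [dilate_symMul]
  have e0 : symMul (dilate n.factorial (ratPoint a)) 0 = dilate n.factorial (ratPoint a) := by
    simp [symMul]
  rw [e0] at key
  rw [key, hQ]
  simp only [Function.comp_apply, hm, Nat.mul_div_cancel_left _ hD0]
  push_cast
  have : (D : ℝ) ≠ 0 := by positivity
  have : (m : ℝ) ≠ 0 := by positivity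
  have : (i : ℝ) ≠ 0 := by positivity
  field_simp

lemma additive {ρ' : Heis → Heis → ℝ} (h : Good c C ρ)
    (hinv : ∀ i j k : ℤ, LeftInvariant ρ (i, j, k)) (h' : Good c C ρ')
    (hlim : ∀ P Q, Tendsto (fun n : ℕ => (n.factorial : ℝ)⁻¹ *
      ρ (dilate n.factorial P) (dilate n.factorial Q)) (hyperfilter ℕ) (𝓝 (ρ' P Q)))
    (P : Heis) (p q s : ℝ) (hs0 : 0 ≤ s) (hs1 : s ≤ 1) :
    ρ' P (symMul P (s * p, s * q, 0)) + ρ' (symMul P (s * p, s * q, 0)) (symMul P (p, q, 0)) =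
      ρ' P (symMul P (p, q, 0)) := by
  set F : Heis × (ℝ × ℝ) × (ℝ × ℝ) → ℝ := fun x =>
    ρ' x.1 (symMul x.1 (|x.2.2.1| * x.2.1.1, |x.2.2.1| * x.2.1.2, 0)) +
    ρ' (symMul x.1 (|x.2.2.1| * x.2.1.1, |x.2.2.1| * x.2.1.2, 0))
      (symMul x.1 ((|x.2.2.1| + |x.2.2.2|) * x.2.1.1, (|x.2.2.1| + |x.2.2.2|) * x.2.1.2, 0)) -
    ρ' x.1
      (symMul x.1 ((|x.2.2.1| + |x.2.2.2|) * x.2.1.1, (|x.2.2.1| + |x.2.2.2|) * x.2.1.2, 0))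
    with hF
  have hc := h'.continuous
  have hFc : Continuous F := by
    refine ((hc.comp (f := fun x : Heis × (ℝ × ℝ) × (ℝ × ℝ) => (_, _)) ?_).add
      (hc.comp (f := fun x : Heis × (ℝ × ℝ) × (ℝ × ℝ) => (_, _)) ?_)).sub
      (hc.comp (f := fun x : Heis × (ℝ × ℝ) × (ℝ × ℝ) => (_, _)) ?_) <;>
    · simp only
      fun_prop
  have hr := Rat.denseRange_cast (𝕜 := ℝ)
  have hd := (hr.prodMap (hr.prodMap hr)).prodMap ((hr.prodMap hr).prodMap (hr.prodMap hr))
  have hF0 : F = fun _ => 0 := by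
    refine hd.equalizer hFc continuous_const (funext ?_)
    rintro ⟨a, ⟨p, q⟩, s, t⟩
    set D : ℚ := s.den * t.den with hD
    have hD0 : D ≠ 0 := by
      have := s.den_ne_zero
      have := t.den_ne_zero
      positivity
    set i : ℕ := s.num.natAbs * t.den with hi
    set j : ℕ := t.num.natAbs * s.den with hj
    have hs : |s| = i / D := by
      rw [eq_div_iff hD0, hD, hi]
      have h1 : |s| * s.den = s.num.natAbs := by
        rw [Nat.cast_natAbs, Int.cast_abs, ← Rat.mul_den_eq_num s, abs_mul, Nat.abs_cast]
      push_cast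
      linear_combination (t.den : ℚ) * h1
    have ht : |t| = j / D := by
      rw [eq_div_iff hD0, hD, hj]
      have h1 : |t| * t.den = t.num.natAbs := by
        rw [Nat.cast_natAbs, Int.cast_abs, ← Rat.mul_den_eq_num t, abs_mul, Nat.abs_cast]
      push_cast
      linear_combination (s.den : ℚ) * h1
    have hs' : |(s : ℝ)| = i / (D : ℝ) := by exact_mod_cast congrArg (fun x : ℚ => (x : ℝ)) hs
    have ht' : |(t : ℝ)| = j / (D : ℝ) := by exact_mod_cast congrArg (fun x : ℚ => (x : ℝ)) ht
    obtain ⟨L, hL⟩ := h.exists_slope hinv hlim (p / D) (q / D)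
    have e1 := hL a i
    have e2 := hL a (i + j)
    have e3 := hL (a.1 + |s| * p, a.2.1 + |s| * q, a.2.2 + (a.1 * (|s| * q) - |s| * p * a.2.1)) j
    have f1 : symMul (ratPoint a) (i * (p / D : ℚ), i * (q / D : ℚ), 0) =
        symMul (ratPoint a) (|(s : ℝ)| * p, |(s : ℝ)| * q, 0) := by
      rw [hs']; push_cast
      simp only [symMul, Prod.mk.injEq]
      exact ⟨by ring, by ring, by ring⟩
    have f2 : symMul (ratPoint a) ((i + j : ℕ) * (p / D : ℚ), (i + j : ℕ) * (q / D : ℚ), 0) =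
        symMul (ratPoint a)
          ((|(s : ℝ)| + |(t : ℝ)|) * p, (|(s : ℝ)| + |(t : ℝ)|) * q, 0) := by
      rw [hs', ht']; push_cast
      simp only [symMul, Prod.mk.injEq]
      exact ⟨by ring, by ring, by ring⟩
    have f3 : ratPoint
        (a.1 + |s| * p, a.2.1 + |s| * q, a.2.2 + (a.1 * (|s| * q) - |s| * p * a.2.1)) =
        symMul (ratPoint a) (|(s : ℝ)| * p, |(s : ℝ)| * q, 0) := by
      simp only [ratPoint, symMul]; push_cast; simp
    have f4 : symMul (symMul (ratPoint a) (|(s : ℝ)| * p, |(s : ℝ)| * q, 0))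
          (j * (p / D : ℚ), j * (q / D : ℚ), 0) =
        symMul (ratPoint a)
          ((|(s : ℝ)| + |(t : ℝ)|) * p, (|(s : ℝ)| + |(t : ℝ)|) * q, 0) := by
      rw [ht']; push_cast
      simp only [symMul, Prod.mk.injEq]
      exact ⟨by ring, by ring, by ring⟩
    rw [f1] at e1
    rw [f2] at e2
    rw [f3, f4] at e3
    change ρ' (ratPoint a) (symMul (ratPoint a) (|(s : ℝ)| * p, |(s : ℝ)| * q, 0)) +
      ρ' (symMul (ratPoint a) (|(s : ℝ)| * p, |(s : ℝ)| * q, 0)) (symMul (ratPoint a)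
          ((|(s : ℝ)| + |(t : ℝ)|) * p, (|(s : ℝ)| + |(t : ℝ)|) * q, 0)) -
      ρ' (ratPoint a) (symMul (ratPoint a)
          ((|(s : ℝ)| + |(t : ℝ)|) * p, (|(s : ℝ)| + |(t : ℝ)|) * q, 0)) = 0
    rw [e1, e2, e3]
    push_cast
    ring
  have := congrFun hF0 (P, (p, q), (s, 1 - s))
  simp only [hF, abs_of_nonneg hs0, abs_of_nonneg (sub_nonneg.2 hs1), add_sub_cancel, one_mul]
    at this
  exact sub_eq_zero.1 this

end Good

theorem not_good {c C : ℝ} (hc : 0 < c) (ρ : Heis → Heis → ℝ) : ¬ Good c C ρ := by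
  intro h
  obtain ⟨ρ₁, h₁, hinv⟩ := h.exists_leftInvariant
  obtain ⟨ρ₂, h₂, hlim⟩ := h₁.exists_blowDown
  exact not_cutCone_of_additive hc (h₁.additive hinv h₂ hlim) h₂.le h₂.ge h₂.cutCone

lemma exists_good_of_embedding {Y : Type*} [MeasurableSpace Y] {ν : Measure Y} {U : Set Heis}
    (hUopen : IsOpen U) (hUne : U.Nonempty) (f : Heis → Lp ℝ 1 ν) {C : ℝ} (hC : 1 ≤ C)
    (hf : ∀ x ∈ U, ∀ y ∈ U,
      (1 / C) * ccDist x y ≤ ‖f x - f y‖ ∧ ‖f x - f y‖ ≤ C * ccDist x y) :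
    ∃ ρ, Good (1 / C / √2) (28 * C) ρ := by
  obtain ⟨x, hx⟩ := hUne
  set P₀ : Heis := (x.1, x.2.1, 2 * x.2.2 - x.1 * x.2.1) with hP₀
  set φ : ℕ → Heis → Heis := fun n P => symMul P₀ (dilate (1 / ((n : ℝ) + 1)) P) with hφ
  have hpos : ∀ n : ℕ, (0 : ℝ) < n + 1 := fun n => by positivity
  have hC0 : 0 < C := by linarith
  have hU : ∀ P, ∀ᶠ n in atTop, toHeis (φ n P) ∈ U := by
    intro P
    have hcont : Continuous fun r : ℝ => toHeis (symMul P₀ (dilate r P)) := by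
      unfold toHeis symMul dilate
      fun_prop
    have h0 : toHeis (symMul P₀ (dilate 0 P)) = x := by
      simp [toHeis, symMul, dilate, hP₀]
    have := hcont.tendsto 0
    rw [h0] at this
    exact (this.comp (tendsto_one_div_add_atTop_nhds_zero_nat (𝕜 := ℝ))).eventually
      (hUopen.mem_nhds hx)
  refine (exists_good_of_eventually (c := 1 / C / √2) (C := 28 * C)
    (ρ := fun n P Q => ((n : ℝ) + 1) * ‖f (toHeis (φ n P)) - f (toHeis (φ n Q))‖)
    (fun n => ((CutCone.of_Lp f).comp fun P => toHeis (φ n P)).smul (hpos n).le) ?_ ?_).imp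
    fun _ h => h.1
  · intro P Q
    filter_upwards [hU P, hU Q] with n hP hQ
    have h1 := (hf _ hP _ hQ).2
    have h2 := ccDist_le_quasiDist (φ n P) (φ n Q)
    rw [hφ, quasiDist_symMul, quasiDist_dilate (one_div_pos.2 (hpos n)).le] at h2
    have h3 := mul_le_mul_of_nonneg_left (h1.trans (mul_le_mul_of_nonneg_left h2 hC0.le))
      (hpos n).le
    refine h3.trans_eq ?_
    have := (hpos n).ne'
    field_simp
  · intro P τ
    filter_upwards [hU P, hU (P.1, P.2.1, P.2.2 + τ)] with n hP hQ
    have h1 := (hf _ hP _ hQ).1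
    set r : ℝ := 1 / ((n : ℝ) + 1) with hr
    have hr0 : 0 < r := one_div_pos.2 (hpos n)
    have e : φ n (P.1, P.2.1, P.2.2 + τ) =
        ((φ n P).1, (φ n P).2.1, (φ n P).2.2 + r ^ 2 * τ) := by
      simp only [hφ, symMul, dilate, Prod.mk.injEq, true_and]
      ring
    have h2 := sqrt_le_ccDist (φ n P) (r ^ 2 * τ)
    rw [← e, abs_mul, abs_sq, mul_div_assoc, Real.sqrt_mul (sq_nonneg r), Real.sqrt_sq hr0.le,
      Real.sqrt_div (abs_nonneg τ)] at h2
    have h3 := mul_le_mul_of_nonneg_left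
      ((mul_le_mul_of_nonneg_left h2 (one_div_pos.2 hC0).le).trans h1) (hpos n).le
    refine le_trans (le_of_eq ?_) h3
    have h4 : ((n : ℝ) + 1) * r = 1 := mul_one_div_cancel (hpos n).ne'
    linear_combination (-(1 / C * (√|τ| / √2))) * h4

/-- No nonempty open subset of the Heisenberg group (with the Carnot–Carathéodory
distance) admits a bi-Lipschitz embedding into `L¹`. -/
theorem statement1 {Y : Type*} [MeasurableSpace Y] (ν : Measure Y) [SigmaFinite ν]
    (U : Set Heis) (hUopen : IsOpen U) (hUne : U.Nonempty)
    (f : Heis → Lp ℝ 1 ν) (C : ℝ) (hC : 1 ≤ C) :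
    ¬ ∀ x ∈ U, ∀ y ∈ U,
        (1 / C) * ccDist x y ≤ ‖f x - f y‖ ∧ ‖f x - f y‖ ≤ C * ccDist x y := by
  intro H
  obtain ⟨ρ, hρ⟩ := exists_good_of_embedding hUopen hUne f hC H
  have hC0 : 0 < C := by linarith
  exact not_good (by positivity) ρ hρ
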